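/- Let G = ⟨s₁,…,s_r⟩ be the free group of rank r. If (T,X,μ,α) is a Markov G-process with H(α) < ∞ and β is a coarsening of α, then f(T,α|β^G) = F(T,α|β^G) = F_*(T,α|β^G) = f_*(T,α|β^G), where β^G is the smallest T(G)-invariant σ-algebra containing β. -/

import Mathlib

open MeasureTheory Filter
open scoped ENNReal symmDiff

namespace Bowen

noncomputable section

/-- The free group of rank `r`. -/
abbrev FG (r : ℕ) := FreeGroup (Fin r)

/-- The generating set element corresponding to `(i, b)`: `sᵢ` if `b = true`,
`sᵢ⁻¹` if `b = false`. -/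
def gen {r : ℕ} (s : Fin r × Bool) : FG r :=
  cond s.2 (FreeGroup.of s.1) (FreeGroup.of s.1)⁻¹

/-- The symmetric generating set `S = {s₁^{±1},…,s_r^{±1}}`. -/
def Sset (r : ℕ) : Set (FG r) := Set.range (gen (r := r))

/-- The ball of radius `n` about the identity in the word metric of `(G,S)`. -/
def ball (r n : ℕ) : Set (FG r) := {g | FreeGroup.norm g ≤ n}

section Partitions

variable {X : Type*} [mX : MeasurableSpace X] {K L : Type*}

/-- Shannon entropy of the countable labeled partition `p` with respect to `μ`
(in `ℝ≥0∞`, so that `H(p) < ∞` is meaningful). -/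
def Hpart (μ : Measure X) (p : X → K) : ℝ≥0∞ :=
  ∑' k : K, ENNReal.ofReal (Real.negMulLog ((μ (p ⁻¹' {k})).toReal))

/-- The atom of the partition `p` containing `x`. -/
def atomOf (p : X → K) (x : X) : Set X := p ⁻¹' {p x}

/-- Conditional Shannon entropy of `p` given the sub-σ-algebra `m`:
`H(p|m) = ∫ -log( μ(A_x | m)(x) ) dμ(x)`. -/
def HpartC (μ : Measure X) (p : X → K) (m : MeasurableSpace X) : ℝ≥0∞ :=
  ∫⁻ x, ENNReal.ofReal
    (- Real.log ((μ[(atomOf p x).indicator (fun _ => (1:ℝ)) | m]) x)) ∂μ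

/-- Join of two labeled partitions. -/
def pjoin (p : X → K) (q : X → L) : X → K × L := fun x => (p x, q x)

/-- Pullback partition `T_g^{-1} p`. -/
def pull {r : ℕ} (T : FG r → X → X) (g : FG r) (p : X → K) : X → K :=
  fun x => p (T g x)

/-- The join `⋁_{q ∈ Q} T_q^{-1} p` over a set `Q ⊆ G`. -/
def powS {r : ℕ} (T : FG r → X → X) (p : X → K) (Q : Set (FG r)) : X → (Q → K) :=
  fun x q => p (T (q : FG r) x)

/-- The join `p^n = ⋁_{g ∈ B(e,n)} T_g^{-1} p`. -/
def pow {r : ℕ} (T : FG r → X → X) (p : X → K) (n : ℕ) : X → (ball r n → K) :=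
  powS T p (ball r n)

/-- The σ-algebra generated by the partition `p`. -/
def sAlg (p : X → K) : MeasurableSpace X := MeasurableSpace.comap p ⊤

/-- The smallest `G`-invariant σ-algebra containing the partition `p`. -/
def sAlgG {r : ℕ} (T : FG r → X → X) (p : X → K) : MeasurableSpace X :=
  ⨆ g : FG r, sAlg (pull T g p)

/-- The σ-algebra `⋁_{f ∈ Q} T_f^{-1} p` for a (possibly infinite) `Q ⊆ G`. -/
def sAlgSet {r : ℕ} (T : FG r → X → X) (p : X → K) (Q : Set (FG r)) :
    MeasurableSpace X :=
  ⨆ f ∈ Q, sAlg (pull T f p)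

/-- `F(T,α) = (1−2r)H(α) + ∑ᵢ H(α ∨ T_{sᵢ}^{-1}α)`. -/
def FF {r : ℕ} (T : FG r → X → X) (μ : Measure X) (p : X → K) : ℝ :=
  (1 - 2 * (r : ℝ)) * (Hpart μ p).toReal
    + ∑ i : Fin r, (Hpart μ (pjoin p (pull T (FreeGroup.of i) p))).toReal

/-- `f(T,α) = inf_{n>0} F(T,α^n)`, as an extended real. -/
def littleF {r : ℕ} (T : FG r → X → X) (μ : Measure X) (p : X → K) : EReal :=
  ⨅ n : ℕ, ((FF T μ (pow T p (n + 1)) : ℝ) : EReal)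

/-- Conditional version `F(T,α|𝓕) = (1−2r)H(α|𝓕) + ∑ᵢ H(α ∨ T_{sᵢ}^{-1}α|𝓕)`. -/
def FFc {r : ℕ} (T : FG r → X → X) (μ : Measure X) (m : MeasurableSpace X)
    (p : X → K) : ℝ :=
  (1 - 2 * (r : ℝ)) * (HpartC (mX := mX) μ p m).toReal
    + ∑ i : Fin r, (HpartC (mX := mX) μ (pjoin p (pull T (FreeGroup.of i) p)) m).toReal

/-- Conditional `f(T,α|𝓕) = inf_{n>0} F(T,α^n|𝓕)`. -/
def littleFc {r : ℕ} (T : FG r → X → X) (μ : Measure X) (m : MeasurableSpace X)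
    (p : X → K) : EReal :=
  ⨅ n : ℕ, ((FFc (mX := mX) T μ m (pow T p (n + 1)) : ℝ) : EReal)

/-- The mean entropy `h(T_s, α) = lim_n H(⋁_{i=0}^n T_s^{-i}α)/(n+1)`; since the
sequence is subadditive the limit equals the infimum, which we take as the
definition. -/
def hrate {r : ℕ} (T : FG r → X → X) (μ : Measure X) (s : FG r) (p : X → K) : ℝ :=
  ⨅ n : ℕ, (Hpart μ (fun x (i : Fin (n + 1)) => p (T (s ^ (i : ℕ)) x))).toReal / (n + 1)

/-- Conditional mean entropy `h(T_s, α|𝓕) = lim_n H(⋁_{i=0}^n T_s^{-i}α | 𝓕)/(n+1)`;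
for an invariant `𝓕` the sequence is subadditive so the limit equals the infimum. -/
def hrateC {r : ℕ} (T : FG r → X → X) (μ : Measure X) (m : MeasurableSpace X)
    (s : FG r) (p : X → K) : ℝ :=
  ⨅ n : ℕ, (HpartC (mX := mX) μ (fun x (i : Fin (n + 1)) => p (T (s ^ (i : ℕ)) x)) m).toReal / (n + 1)

/-- `F_*(T,α) = (1−r)H(α) + ∑ᵢ h(T_{sᵢ},α)`. -/
def Fstar {r : ℕ} (T : FG r → X → X) (μ : Measure X) (p : X → K) : ℝ :=
  (1 - (r : ℝ)) * (Hpart μ p).toReal + ∑ i : Fin r, hrate T μ (FreeGroup.of i) p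

/-- `f_*(T,α) = inf_{n>0} F_*(T,α^n)`. -/
def fstar {r : ℕ} (T : FG r → X → X) (μ : Measure X) (p : X → K) : EReal :=
  ⨅ n : ℕ, ((Fstar T μ (pow T p (n + 1)) : ℝ) : EReal)

/-- `F_*(T,α|𝓕) = (1−r)H(α|𝓕) + ∑ᵢ h(T_{sᵢ},α|𝓕)`. -/
def FstarC {r : ℕ} (T : FG r → X → X) (μ : Measure X) (m : MeasurableSpace X)
    (p : X → K) : ℝ :=
  (1 - (r : ℝ)) * (HpartC (mX := mX) μ p m).toReal + ∑ i : Fin r, hrateC (mX := mX) T μ m (FreeGroup.of i) p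

/-- `f_*(T,α|𝓕) = inf_{n>0} F_*(T,α^n|𝓕)`. -/
def fstarC {r : ℕ} (T : FG r → X → X) (μ : Measure X) (m : MeasurableSpace X)
    (p : X → K) : EReal :=
  ⨅ n : ℕ, ((FstarC (mX := mX) T μ m (pow T p (n + 1)) : ℝ) : EReal)

/-- `p` refines `q`: each atom of `p` is contained, up to a `μ`-null set,
in an atom of `q`. -/
def Refines (μ : Measure X) (p : X → K) (q : X → L) : Prop :=
  ∀ k : K, ∃ l : L, μ (p ⁻¹' {k} \ q ⁻¹' {l}) = 0

/-- Two labeled partitions are equal as partitions (up to null sets). -/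
def PartEquiv (μ : Measure X) (p : X → K) (q : X → L) : Prop :=
  Refines μ p q ∧ Refines μ q p

/-- `σ` is a simple splitting of `p`: `σ = p ∨ T_s^{-1}β` for some `s ∈ S` and
some coarsening `β` of `p`. -/
def SimpleSplit {r : ℕ} (μ : Measure X) (T : FG r → X → X) (p σ : X → ℕ) : Prop :=
  ∃ s ∈ Sset r, ∃ β : X → ℕ, Measurable β ∧ Refines μ p β ∧
    PartEquiv μ σ (pjoin p (pull T s β))

/-- `τ` is a splitting of `p`: obtained from `p` by a finite sequence of simple
splittings (as a partition, i.e. up to relabeling and null sets). -/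
def IsSplitting {r : ℕ} (μ : Measure X) (T : FG r → X → X) (p : X → ℕ)
    (τ : X → K) : Prop :=
  ∃ σ : X → ℕ, Relation.ReflTransGen (SimpleSplit μ T) p σ ∧ PartEquiv μ σ τ

/-- A partition is generating if the smallest `G`-invariant σ-algebra containing it
is the full σ-algebra up to `μ`-null sets. -/
def Generating {r : ℕ} (T : FG r → X → X) (μ : Measure X) (p : X → K) : Prop :=
  ∀ A : Set X, MeasurableSet A →
    ∃ A' : Set X, MeasurableSet[sAlgG T p] A' ∧ μ (A ∆ A') = 0

/-- The Rohlin distance `d(α,β) = H(α|β) + H(β|α)`. -/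
def rohlinDist (μ : Measure X) (p : X → K) (q : X → L) : ℝ :=
  (HpartC μ p (sAlg q)).toReal + (HpartC μ q (sAlg p)).toReal

end Partitions

/-- Adjacency in the left Cayley graph `Γ_L`: an edge joins `a` and `sa`, `s ∈ S`. -/
def adjL {r : ℕ} (a b : FG r) : Prop := ∃ s ∈ Sset r, b = s * a

/-- `Past(g₁;g₂)`: the set of `f ∈ G` such that every path in the left Cayley
graph from `f` to `g₁` passes through `g₂`. -/
def Past {r : ℕ} (g₁ g₂ : FG r) : Set (FG r) :=
  {f | ∀ l : List (FG r), l ≠ [] → l.head? = some f → l.getLast? = some g₁ →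
        l.Chain' adjL → g₂ ∈ l}

/-- A subset `F ⊆ G` is right-connected: the subgraph of the right Cayley graph
induced on `F` is connected. -/
def RightConnected {r : ℕ} (F : Set (FG r)) : Prop :=
  ∀ g ∈ F, ∀ h ∈ F,
    Relation.ReflTransGen (fun a b => a ∈ F ∧ b ∈ F ∧ ∃ s ∈ Sset r, b = a * s) g h

/-- A subset `F ⊆ G` is left-connected: the subgraph of the left Cayley graph
induced on `F` is connected. -/
def LeftConnected {r : ℕ} (F : Set (FG r)) : Prop :=
  ∀ g ∈ F, ∀ h ∈ F,
    Relation.ReflTransGen (fun a b => a ∈ F ∧ b ∈ F ∧ ∃ s ∈ Sset r, b = s * a) g h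

section Markov

variable {X : Type*} [MeasurableSpace X] {K : Type*}

/-- A `G`-process `(T,X,μ,α)` is Markov: for every `s ∈ S`, `g ∈ G` and every atom
`A` of `α`, `μ(T_{sg}^{-1}A | ⋁_{f∈Past(sg;g)} T_f^{-1}α) = μ(T_{sg}^{-1}A | T_g^{-1}α)`
almost everywhere. -/
def IsMarkov {r : ℕ} (μ : Measure X) (T : FG r → X → X) (p : X → K) : Prop :=
  ∀ s ∈ Sset r, ∀ g : FG r, ∀ k : K,
    (μ[((pull T (s * g) p) ⁻¹' {k}).indicator (fun _ => (1:ℝ)) |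
        sAlgSet T p (Past (s * g) g)])
      =ᵐ[μ]
    (μ[((pull T (s * g) p) ⁻¹' {k}).indicator (fun _ => (1:ℝ)) |
        sAlg (pull T g p)])

end Markov


section ExtraDefs

/-- The distance `d₁` between two ordered processes:
`∑_{s∈S} ∑_{i,j} |μ(A_i ∩ T_s^{-1}A_j) − ν(B_i ∩ U_s^{-1}B_j)|`. -/
def d1 {X Y : Type*} [MeasurableSpace X] [MeasurableSpace Y] {r : ℕ}
    (T : FG r → X → X) (μ : Measure X) (α : X → ℕ)
    (U : FG r → Y → Y) (ν : Measure Y) (β : Y → ℕ) : ℝ :=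
  ∑ i : Fin r, ∑ b : Bool,
    ∑' ij : ℕ × ℕ,
      |(μ (α ⁻¹' {ij.1} ∩ pull T (gen (i, b)) α ⁻¹' {ij.2})).toReal -
        (ν (β ⁻¹' {ij.1} ∩ pull U (gen (i, b)) β ⁻¹' {ij.2})).toReal|

/-- Isomorphism of ordered processes: a measure conjugacy between conull sets
intertwining the actions and carrying the `i`-th atom to the `i`-th atom. -/
def OrderedIso {X Y : Type*} [MeasurableSpace X] [MeasurableSpace Y] {r : ℕ}
    (T : FG r → X → X) (μ : Measure X) (α : X → ℕ)
    (U : FG r → Y → Y) (ν : Measure Y) (β : Y → ℕ) : Prop :=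
  ∃ (X' : Set X) (Y' : Set Y) (φ : X → Y) (ψ : Y → X),
    MeasurableSet X' ∧ MeasurableSet Y' ∧ μ X'ᶜ = 0 ∧ ν Y'ᶜ = 0 ∧
    Measurable φ ∧ Measurable ψ ∧ Set.MapsTo φ X' Y' ∧ Set.MapsTo ψ Y' X' ∧
    (∀ x ∈ X', ψ (φ x) = x) ∧ (∀ y ∈ Y', φ (ψ y) = y) ∧
    Measure.map φ μ = ν ∧
    (∀ (g : FG r), ∀ x ∈ X', φ (T g x) = U g (φ x)) ∧
    (∀ x ∈ X', β (φ x) = α x)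

/-- A transition system for `(G,S)`: a family of `K × K` matrices indexed by the
generating set together with a row vector, written as functions. -/
structure TransSys (r : ℕ) (K : Type*) where
  P : Fin r × Bool → K → K → ℝ
  pi : K → ℝ

/-- The transition system is an invariant transition system: the `P^s` are
stochastic matrices, `π` is a probability vector which is a steady state vector
for every `P^s`, and `π_i P^{s^{-1}}_{ij} = π_j P^s_{ji}`. -/
def TransSys.IsInvariant {r : ℕ} {K : Type*} (ts : TransSys r K) : Prop :=
  (∀ s i j, 0 ≤ ts.P s i j) ∧ (∀ s i, HasSum (ts.P s i) 1) ∧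
    (∀ i, 0 ≤ ts.pi i) ∧ HasSum ts.pi 1 ∧
    (∀ s j, HasSum (fun i => ts.pi i * ts.P s i j) (ts.pi j)) ∧
    (∀ s i j, ts.pi i * ts.P (s.1, !s.2) i j = ts.pi j * ts.P s j i)

/-- The canonical (shift) action of `G` on `K^G`: `(T_g x)(f) = x(fg)`. -/
def shiftT {r : ℕ} {K : Type*} : FG r → (FG r → K) → (FG r → K) :=
  fun g x f => x (f * g)

/-- `μ` is (a measure) induced by the transition system `ts`: the time-`e`
distribution is `π` and the transition probabilities into the complement of the
past are given by the matrices `P^s`.  (Note `T_g^{-1}A_k = {x : x(g) = k}`;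
the conditional equalities `μ(A|B) = c` are recorded in the equivalent product
form `μ(A ∩ B) = c·μ(B)`.) -/
def IsInducedBy {r : ℕ} {K : Type*} [MeasurableSpace K]
    (μ : Measure (FG r → K)) (ts : TransSys r K) : Prop :=
  (∀ k : K, μ {x | x 1 = k} = ENNReal.ofReal (ts.pi k)) ∧
  ∀ (s : Fin r × Bool) (g : FG r),
    FreeGroup.norm (gen s * g) = FreeGroup.norm g + 1 →
    ∀ (n : ℕ) (fs : Fin n → FG r) (ks : Fin n → K) (k₀ k : K),
      (∀ i, fs i ∈ Past (gen s * g) g ∧ fs i ≠ g) →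
      (μ ({x | x (gen s * g) = k} ∩ ({x | x g = k₀} ∩ ⋂ i, {x | x (fs i) = ks i}))
          = ENNReal.ofReal (ts.P s k₀ k) * μ ({x | x g = k₀} ∩ ⋂ i, {x | x (fs i) = ks i})) ∧
      μ ({x | x (gen s * g) = k} ∩ {x | x g = k₀})
          = ENNReal.ofReal (ts.P s k₀ k) * μ {x | x g = k₀}

end ExtraDefs


section Part1

section CondBasics

/-- The real indicator function of a set. -/
abbrev ind {X : Type*} (A : Set X) : X → ℝ := A.indicator (fun _ => (1:ℝ))

variable {X : Type*} {m m1 m2 M P N C Fp Ff Q : MeasurableSpace X} [mX : MeasurableSpace X]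
  {μ : Measure X} [IsProbabilityMeasure μ]

lemma integrable_ind {A : Set X} (hA : MeasurableSet A) : Integrable (ind A) μ :=
  (integrable_const (1:ℝ)).indicator hA

lemma condExp_ind_bdd {A : Set X} (hA : MeasurableSet A) (hm : m ≤ mX) :
    ∀ᵐ x ∂μ, 0 ≤ μ[ind A | m] x ∧ μ[ind A | m] x ≤ 1 := by
  have h0 : 0 ≤ᵐ[μ] μ[ind A | m] := condExp_nonneg
    (Eventually.of_forall fun x => Set.indicator_nonneg (fun _ _ => zero_le_one) x)
  have h1 : μ[ind A | m] ≤ᵐ[μ] μ[fun _ => (1:ℝ) | m] :=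
    condExp_mono (integrable_ind hA) (integrable_const _)
      (Eventually.of_forall fun x => Set.indicator_le_self' (fun _ _ => zero_le_one) x)
  rw [condExp_const hm] at h1
  filter_upwards [h0, h1] with x h0 h1 using ⟨h0, h1⟩

lemma condExp_eq_of_pi {f : X → ℝ} (h21 : m2 ≤ m1) (h1 : m1 ≤ mX) (S : Set (Set X))
    (hS : m1 = MeasurableSpace.generateFrom S) (hpi : IsPiSystem S) (hf : Integrable f μ)
    (h : ∀ s ∈ S, ∫ x in s, μ[f | m2] x ∂μ = ∫ x in s, f x ∂μ) :
    μ[f | m1] =ᵐ[μ] μ[f | m2] := by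
  symm
  refine ae_eq_condExp_of_forall_setIntegral_eq h1 hf
    (fun s _ _ => integrable_condExp.integrableOn) ?_
    (stronglyMeasurable_condExp.mono h21).aestronglyMeasurable
  intro s hs _
  have key : ∀ s, MeasurableSet[m1] s → ∫ x in s, μ[f | m2] x ∂μ = ∫ x in s, f x ∂μ := by
    refine MeasurableSpace.induction_on_inter (m := m1)
      (C := fun s _ => ∫ x in s, μ[f | m2] x ∂μ = ∫ x in s, f x ∂μ) hS hpi ?_ ?_ ?_ ?_
    · simp
    · intro t ht; exact h t ht
    · intro t ht ih
      rw [setIntegral_compl (h1 _ ht) integrable_condExp, setIntegral_compl (h1 _ ht) hf, ih,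
        integral_condExp (h21.trans h1)]
    · intro g hd hg ih
      rw [integral_iUnion (fun i => h1 _ (hg i)) hd integrable_condExp.integrableOn,
        integral_iUnion (fun i => h1 _ (hg i)) hd hf.integrableOn]
      exact tsum_congr ih
  exact key s hs

lemma condExp_squeeze {f : X → ℝ} (h2 : m2 ≤ m) (h1 : m ≤ m1) (hX : m1 ≤ mX)
    (h : μ[f | m1] =ᵐ[μ] μ[f | m2]) : μ[f | m] =ᵐ[μ] μ[f | m2] := by
  calc μ[f | m] =ᵐ[μ] μ[μ[f | m1] | m] := (condExp_condExp_of_le h1 hX).symm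
    _ =ᵐ[μ] μ[μ[f | m2] | m] := condExp_congr_ae h
    _ =ᵐ[μ] μ[f | m2] := by
        rw [condExp_of_stronglyMeasurable (h1.trans hX) (stronglyMeasurable_condExp.mono h2)
          integrable_condExp]

lemma ind_mul_eq (A : Set X) (f : X → ℝ) : (ind A * f) = A.indicator f := by
  ext x; by_cases h : x ∈ A <;> simp [ind, h]

/-- `∫_e 1_A f = ∫_e μ[1_A|M] f` for `f` bounded and `M`-measurable. -/
lemma setIntegral_pull {A e : Set X} (hM : M ≤ mX) (hA : MeasurableSet A)
    (he : MeasurableSet[M] e) {f : X → ℝ} (hf : StronglyMeasurable[M] f) (hfi : Integrable f μ) :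
    ∫ x in e ∩ A, f x ∂μ = ∫ x in e, μ[ind A | M] x * f x ∂μ := by
  have hi : Integrable (ind A * f) μ := by rw [ind_mul_eq]; exact hfi.indicator hA
  have h := condExp_mul_of_stronglyMeasurable_right (μ := μ) (m := M) (f := ind A) hf
    hi (integrable_ind hA)
  have : ∫ x in e, μ[ind A | M] x * f x ∂μ = ∫ x in e, (ind A * f) x ∂μ := by
    rw [← setIntegral_condExp hM hi he]
    exact (setIntegral_congr_ae (hM _ he) (h.mono fun x hx _ => hx)).symm
  rw [this, ind_mul_eq, setIntegral_indicator hA]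

lemma condIndep_symm (hM : M ≤ mX) (hP : P ≤ mX) (hN : N ≤ mX) (S : Set (Set X))
    (hS : N = MeasurableSpace.generateFrom S) (hpi : IsPiSystem S) (huniv : Set.univ ∈ S)
    (h : ∀ A ∈ S, μ[ind A | M ⊔ P] =ᵐ[μ] μ[ind A | M]) {p : Set X} (hp : MeasurableSet[P] p) :
    μ[ind p | M ⊔ N] =ᵐ[μ] μ[ind p | M] := by
  have hSN : ∀ A ∈ S, MeasurableSet[N] A := fun A hA => by
    rw [hS]; exact MeasurableSpace.measurableSet_generateFrom hA
  refine condExp_eq_of_pi le_sup_left (sup_le hM hN)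
    {s | ∃ e, MeasurableSet[M] e ∧ ∃ a ∈ S, s = e ∩ a} ?_ ?_ (integrable_ind (hP _ hp)) ?_
  · apply le_antisymm
    · refine sup_le ?_ ?_
      · intro e he
        exact MeasurableSpace.measurableSet_generateFrom ⟨e, he, Set.univ, huniv, by simp⟩
      · rw [hS]
        refine MeasurableSpace.generateFrom_mono ?_
        intro a ha
        exact ⟨Set.univ, MeasurableSet.univ, a, ha, by simp⟩
    · refine MeasurableSpace.generateFrom_le ?_
      rintro s ⟨e, he, a, ha, rfl⟩
      exact MeasurableSet.inter (le_sup_left (a := M) (b := N) _ he)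
        (le_sup_right (a := M) (b := N) _ (hSN a ha))
  · rintro s ⟨e, he, a, ha, rfl⟩ s' ⟨e', he', a', ha', rfl⟩ hne
    refine ⟨e ∩ e', MeasurableSet.inter he he', a ∩ a', hpi a ha a' ha' ?_, ?_⟩
    · obtain ⟨x, hx⟩ := hne; exact ⟨x, hx.1.2, hx.2.2⟩
    · ext x; simp only [Set.mem_inter_iff]; tauto
  · rintro s ⟨e, he, a, ha, rfl⟩
    have haX := hN _ (hSN a ha)
    have hpX := hP _ hp
    rw [setIntegral_pull hM haX he stronglyMeasurable_condExp integrable_condExp]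
    have e1 : ∫ x in e ∩ a, ind p x ∂μ = ∫ x in e ∩ p, ind a x ∂μ := by
      rw [setIntegral_indicator hpX, setIntegral_indicator haX]
      congr 2; ext x; simp only [Set.mem_inter_iff]; tauto
    have hep : MeasurableSet[M ⊔ P] (e ∩ p) :=
      MeasurableSet.inter (le_sup_left (a := M) (b := P) _ he) (le_sup_right (a := M) (b := P) _ hp)
    have e2 : ∫ x in e ∩ p, ind a x ∂μ = ∫ x in e ∩ p, μ[ind a | M] x ∂μ := by
      rw [← setIntegral_condExp (sup_le hM hP) (integrable_ind haX) hep]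
      exact setIntegral_congr_ae (sup_le hM hP _ hep) ((h a ha).mono fun x hx _ => hx)
    rw [e1, e2, setIntegral_pull hM hpX he stronglyMeasurable_condExp integrable_condExp]
    simp_rw [mul_comm]

lemma sAlg_eq_generateFrom (q : X → ℕ) : sAlg q = MeasurableSpace.generateFrom
    {A | A = Set.univ ∨ A = ∅ ∨ ∃ k, A = q ⁻¹' {k}} := by
  apply le_antisymm
  · rintro s ⟨C, -, rfl⟩
    have : q ⁻¹' C = ⋃ k ∈ C, q ⁻¹' {k} := by ext x; simp
    rw [this]
    exact MeasurableSet.biUnion (Set.to_countable C) fun k _ =>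
      MeasurableSpace.measurableSet_generateFrom (Or.inr (Or.inr ⟨k, rfl⟩))
  · refine MeasurableSpace.generateFrom_le ?_
    rintro s (rfl | rfl | ⟨k, rfl⟩)
    · exact @MeasurableSet.univ X (sAlg q)
    · exact @MeasurableSet.empty X (sAlg q)
    · exact ⟨{k}, trivial, rfl⟩

lemma isPiSystem_atoms (q : X → ℕ) :
    IsPiSystem {A | A = Set.univ ∨ A = ∅ ∨ ∃ k, A = q ⁻¹' {k}} := by
  rintro s hs t ht hne
  rcases hs with rfl | rfl | ⟨k, rfl⟩
  · simpa using ht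
  · simp at hne
  · rcases ht with rfl | rfl | ⟨l, rfl⟩
    · right; right; exact ⟨k, by simp⟩
    · simp at hne
    · obtain ⟨x, hx1, hx2⟩ := hne
      simp only [Set.mem_preimage, Set.mem_singleton_iff] at hx1 hx2
      right; right; refine ⟨k, ?_⟩
      rw [← hx1, ← hx2, Set.inter_self]

lemma condIndep_symm_atoms (hM : M ≤ mX) (hP : P ≤ mX) {q : X → ℕ} (hq : Measurable q)
    (h : ∀ k, μ[ind (q ⁻¹' {k}) | M ⊔ P] =ᵐ[μ] μ[ind (q ⁻¹' {k}) | M])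
    {p : Set X} (hp : MeasurableSet[P] p) :
    μ[ind p | M ⊔ sAlg q] =ᵐ[μ] μ[ind p | M] := by
  refine condIndep_symm hM hP ?_ _ (sAlg_eq_generateFrom q) (isPiSystem_atoms q) (Or.inl rfl) ?_ hp
  · rintro s ⟨C, -, rfl⟩; exact hq (MeasurableSet.of_discrete)
  · rintro A (rfl | rfl | ⟨k, rfl⟩)
    · have : (ind (Set.univ : Set X)) = fun _ => (1:ℝ) := by ext; simp [ind]
      rw [this, condExp_const hM, condExp_const (sup_le hM hP)]
    · have : (ind (∅ : Set X)) = fun _ => (0:ℝ) := by ext; simp [ind]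
      rw [this, condExp_const hM, condExp_const (sup_le hM hP)]
    · exact h k

/-- conditional independence passes to increasing unions -/
lemma condIndep_iSup (hM : M ≤ mX) {Ns : ℕ → MeasurableSpace X} (hmono : Monotone Ns)
    (hN : ∀ k, Ns k ≤ mX) {f : X → ℝ} (hf : Integrable f μ)
    (h : ∀ k, μ[f | M ⊔ Ns k] =ᵐ[μ] μ[f | M]) :
    μ[f | M ⊔ ⨆ k, Ns k] =ᵐ[μ] μ[f | M] := by
  have hsup : M ⊔ ⨆ k, Ns k = ⨆ k, (M ⊔ Ns k) := sup_iSup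
  refine condExp_eq_of_pi le_sup_left (sup_le hM (iSup_le hN))
    (⋃ k, {s | MeasurableSet[M ⊔ Ns k] s}) ?_ ?_ hf ?_
  · rw [hsup]; exact (MeasurableSpace.generateFrom_iUnion_measurableSet _).symm
  · refine isPiSystem_iUnion_of_monotone _ (fun k => ?_) ?_
    · exact @MeasurableSpace.isPiSystem_measurableSet X (M ⊔ Ns k)
    · intro i j hij s hs
      exact sup_le_sup_left (hmono hij) M _ hs
  · intro s hs
    obtain ⟨k, hk⟩ := Set.mem_iUnion.1 hs
    have hle : M ⊔ Ns k ≤ mX := sup_le hM (hN k)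
    rw [← setIntegral_condExp hle hf hk]
    exact setIntegral_congr_ae (hle _ hk) ((h k).mono fun x hx _ => hx.symm)

/-- The final conditional independence statement. -/
lemma markov_cond (hC : C ≤ mX) (hP : P ≤ mX) (hN : N ≤ mX)
    (hCP : C ≤ P) (hFp : Fp ≤ P) (hFf : Ff ≤ N) (hCQ : C ≤ Q) (hQP : Q ≤ P)
    (h : ∀ p, MeasurableSet[P] p → μ[ind p | C ⊔ N] =ᵐ[μ] μ[ind p | C])
    {A : Set X} (hA : MeasurableSet[N] A) :
    μ[ind A | Q ⊔ (Fp ⊔ Ff)] =ᵐ[μ] μ[ind A | C ⊔ Ff] := by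
  have hFfX : Ff ≤ mX := hFf.trans hN
  have key : μ[ind A | (C ⊔ Ff) ⊔ P] =ᵐ[μ] μ[ind A | C ⊔ Ff] := by
    refine condIndep_symm (sup_le hC hFfX) hN hP {s | MeasurableSet[P] s}
      (@MeasurableSpace.generateFrom_measurableSet X P).symm
      (@MeasurableSpace.isPiSystem_measurableSet X P) (@MeasurableSet.univ X P) ?_ hA
    intro p hp
    have e1 : C ⊔ Ff ⊔ N = C ⊔ N := by rw [sup_assoc, sup_eq_right.2 hFf]
    have e2 := h p hp
    rw [e1]
    refine e2.trans ?_
    exact (condExp_squeeze le_sup_left (sup_le_sup_left hFf C) (sup_le hC hN) e2).symm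
  refine condExp_squeeze (sup_le (hCQ.trans le_sup_left) (le_sup_right.trans le_sup_right)) ?_
    (sup_le (sup_le hC hFfX) hP) key
  refine sup_le (hQP.trans le_sup_right) (sup_le (hFp.trans le_sup_right) ?_)
  exact le_sup_right.trans le_sup_left

end CondBasics

end Part1

section Part2

section Entropy

variable {X : Type*} {m m1 m2 : MeasurableSpace X} [mX : MeasurableSpace X]
  {μ : Measure X} [IsProbabilityMeasure μ] {K L : Type*}

lemma measurable_glue [Countable K] {p : X → K} (hp : ∀ k, MeasurableSet (p ⁻¹' {k}))
    {g : K → X → ℝ≥0∞} (hg : ∀ k, Measurable (g k)) : Measurable (fun x => g (p x) x) := by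
  intro s hs
  have : (fun x => g (p x) x) ⁻¹' s = ⋃ k, p ⁻¹' {k} ∩ g k ⁻¹' s := by
    ext x; simp
  rw [this]
  exact MeasurableSet.iUnion fun k => (hp k).inter (hg k hs)

/-- The information function of a single atom. -/
def info (μ : Measure X) (A : Set X) (m : MeasurableSpace X) : X → ℝ≥0∞ :=
  fun x => ENNReal.ofReal (- Real.log (μ[ind A | m] x))

lemma measurable_info (A : Set X) (hm : m ≤ mX) : Measurable[m] (info μ A m) := by
  unfold info
  exact ((stronglyMeasurable_condExp (m := m)).measurable.log.neg).ennreal_ofReal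

lemma HpartC_eq_lintegral (p : X → K) :
    HpartC μ p m = ∫⁻ x, info μ (p ⁻¹' {p x}) m x ∂μ := rfl

lemma HpartC_eq_tsum [Countable K] {p : X → K} (hp : ∀ k, MeasurableSet (p ⁻¹' {k})) :
    HpartC μ p m = ∑' k, ∫⁻ x in p ⁻¹' {k}, info μ (p ⁻¹' {k}) m x ∂μ := by
  rw [HpartC_eq_lintegral, ← setLIntegral_univ]
  have : (Set.univ : Set X) = ⋃ k, p ⁻¹' {k} := by ext x; simp
  rw [this, lintegral_iUnion hp]
  · refine tsum_congr fun k => ?_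
    refine setLIntegral_congr_fun (hp k) ?_
    intro x hx
    simp only [Set.mem_preimage, Set.mem_singleton_iff] at hx
    simp only [hx]
  · intro i j hij
    refine Set.disjoint_left.2 fun x hx hy => hij ?_
    simp only [Set.mem_preimage, Set.mem_singleton_iff] at hx hy
    rw [← hx, ← hy]

lemma HpartC_congr_condExp [Countable K] {p : X → K} (hp : ∀ k, MeasurableSet (p ⁻¹' {k}))
    (h : ∀ k, μ[ind (p ⁻¹' {k}) | m1] =ᵐ[μ] μ[ind (p ⁻¹' {k}) | m2]) :
    HpartC μ p m1 = HpartC μ p m2 := by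
  rw [HpartC_eq_tsum hp, HpartC_eq_tsum hp]
  refine tsum_congr fun k => ?_
  refine lintegral_congr_ae (ae_restrict_of_ae ?_)
  filter_upwards [h k] with x hx
  simp only [info, hx]

lemma HpartC_congr_ker {p : X → K} {q : X → L} (h : ∀ x y, p x = p y ↔ q x = q y) :
    HpartC μ p m = HpartC μ q m := by
  rw [HpartC_eq_lintegral, HpartC_eq_lintegral]
  congr 1; ext x
  have : p ⁻¹' {p x} = q ⁻¹' {q x} := by ext y; simp [h y x]
  rw [this]

lemma lintegral_pull {A : Set X} (hA : MeasurableSet A) (hm : m ≤ mX) {g : X → ℝ≥0∞}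
    (hg : Measurable[m] g) :
    ∫⁻ x in A, g x ∂μ = ∫⁻ x, ENNReal.ofReal (μ[ind A | m] x) * g x ∂μ := by
  have hY : Measurable (fun x => ENNReal.ofReal (μ[ind A | m] x)) :=
    ((stronglyMeasurable_condExp.mono hm).measurable).ennreal_ofReal
  have key : (μ.restrict A).trim hm
      = (μ.withDensity (fun x => ENNReal.ofReal (μ[ind A | m] x))).trim hm := by
    refine @Measure.ext X m _ _ fun s hs => ?_
    rw [trim_measurableSet_eq hm hs, trim_measurableSet_eq hm hs, Measure.restrict_apply (hm _ hs),
      withDensity_apply _ (hm _ hs)]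
    have h0 : 0 ≤ᵐ[μ.restrict s] μ[ind A | m] :=
      ae_restrict_of_ae ((condExp_ind_bdd hA hm).mono fun x hx => hx.1)
    rw [← ofReal_integral_eq_lintegral_ofReal integrable_condExp.integrableOn h0,
      setIntegral_condExp hm (integrable_ind hA) hs, setIntegral_indicator hA]
    simp
  calc ∫⁻ x in A, g x ∂μ = ∫⁻ x, g x ∂((μ.restrict A).trim hm) := (lintegral_trim hm hg).symm
    _ = ∫⁻ x, g x ∂(μ.withDensity (fun x => ENNReal.ofReal (μ[ind A | m] x))) := by
        rw [key, lintegral_trim hm hg]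
    _ = _ := by
        rw [lintegral_withDensity_eq_lintegral_mul _ hY (hg.mono hm le_rfl)]
        rfl

lemma info_eq_negMulLog {A : Set X} (hA : MeasurableSet A) (hm : m ≤ mX) :
    ∫⁻ x in A, info μ A m x ∂μ = ∫⁻ x, ENNReal.ofReal (Real.negMulLog (μ[ind A | m] x)) ∂μ := by
  rw [lintegral_pull hA hm (measurable_info A hm)]
  refine lintegral_congr_ae ?_
  filter_upwards [condExp_ind_bdd hA hm] with x hx
  simp only [info]
  rw [← ENNReal.ofReal_mul hx.1, Real.negMulLog]
  congr 1; ring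

lemma integrable_negMulLog {A : Set X} (hA : MeasurableSet A) (hm : m ≤ mX) :
    Integrable (fun x => Real.negMulLog (μ[ind A | m] x)) μ := by
  obtain ⟨c, hc⟩ := (isCompact_Icc (a := (0:ℝ)) (b := 1)).exists_bound_of_continuousOn
    Real.continuous_negMulLog.continuousOn
  refine Integrable.of_bound (C := c) ?_ ?_
  · exact (Real.continuous_negMulLog.comp_stronglyMeasurable
      (stronglyMeasurable_condExp.mono hm)).aestronglyMeasurable
  · filter_upwards [condExp_ind_bdd hA hm] with x hx using hc _ hx

lemma HpartC_anti [Countable K] {p : X → K} (hp : ∀ k, MeasurableSet (p ⁻¹' {k}))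
    (h21 : m2 ≤ m1) (h1 : m1 ≤ mX) : HpartC μ p m1 ≤ HpartC μ p m2 := by
  rw [HpartC_eq_tsum hp, HpartC_eq_tsum hp]
  refine ENNReal.tsum_le_tsum fun k => ?_
  have h2 := h21.trans h1
  set A := p ⁻¹' {k}
  have hA : MeasurableSet A := hp k
  have nn1 : 0 ≤ᵐ[μ] fun x => Real.negMulLog (μ[ind A | m1] x) := by
    filter_upwards [condExp_ind_bdd hA h1] with x hx using Real.negMulLog_nonneg hx.1 hx.2
  have nn2 : 0 ≤ᵐ[μ] fun x => Real.negMulLog (μ[ind A | m2] x) := by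
    filter_upwards [condExp_ind_bdd hA h2] with x hx using Real.negMulLog_nonneg hx.1 hx.2
  rw [info_eq_negMulLog hA h1, info_eq_negMulLog hA h2,
    ← ofReal_integral_eq_lintegral_ofReal (integrable_negMulLog hA h1) nn1,
    ← ofReal_integral_eq_lintegral_ofReal (integrable_negMulLog hA h2) nn2]
  refine ENNReal.ofReal_le_ofReal ?_
  have hj := ConcaveOn.condExp_map_le (μ := μ) (f := μ[ind A | m1]) h2 Real.concaveOn_negMulLog
    (Real.continuous_negMulLog.upperSemicontinuous.upperSemicontinuousOn _)
    ((condExp_ind_bdd hA h1).mono fun x hx => hx.1) isClosed_Ici integrable_condExp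
    (integrable_negMulLog hA h1)
  rw [← integral_condExp h2 (f := fun x => Real.negMulLog (μ[ind A | m1] x))]
  refine integral_mono_ae integrable_condExp (integrable_negMulLog hA h2) ?_
  filter_upwards [hj, condExp_condExp_of_le (f := ind A) (μ := μ) h21 h1] with x hx hx2
  simp only [Function.comp_apply, hx2] at hx
  exact hx

lemma HpartC_bot [Countable K] {p : X → K} (hp : ∀ k, MeasurableSet (p ⁻¹' {k})) :
    HpartC μ p ⊥ = Hpart μ p := by
  rw [HpartC_eq_tsum hp, Hpart]
  refine tsum_congr fun k => ?_
  rw [info_eq_negMulLog (hp k) bot_le]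
  simp only [condExp_bot]
  have : ∫ x, ind (p ⁻¹' {k}) x ∂μ = (μ (p ⁻¹' {k})).toReal := by
    rw [integral_indicator (hp k)]; simp [Measure.real]
  rw [this]; simp

lemma HpartC_le_Hpart [Countable K] {p : X → K} (hp : ∀ k, MeasurableSet (p ⁻¹' {k}))
    (hm : m ≤ mX) : HpartC μ p m ≤ Hpart μ p := by
  rw [← HpartC_bot hp]; exact HpartC_anti hp bot_le hm

lemma trace_sup {q : X → L} (l : L) {s : Set X} (hs : MeasurableSet[sAlg q ⊔ m] s) :
    ∃ e, MeasurableSet[m] e ∧ s ∩ q ⁻¹' {l} = e ∩ q ⁻¹' {l} := by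
  have : sAlg q ⊔ m = MeasurableSpace.generateFrom
      ({s | MeasurableSet[sAlg q] s} ∪ {s | MeasurableSet[m] s}) := by
    rw [MeasurableSpace.generateFrom_sup_generateFrom.symm,
      @MeasurableSpace.generateFrom_measurableSet X (sAlg q),
      @MeasurableSpace.generateFrom_measurableSet X m]
  rw [this] at hs
  induction s, hs using MeasurableSpace.generateFrom_induction with
  | hC t ht _ =>
    rcases ht with ⟨C, -, rfl⟩ | ht
    · by_cases hl : l ∈ C
      · refine ⟨Set.univ, @MeasurableSet.univ X m, ?_⟩
        ext x; simp only [Set.mem_inter_iff, Set.mem_preimage, Set.mem_singleton_iff, Set.mem_univ]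
        constructor
        · rintro ⟨_, h⟩; exact ⟨trivial, h⟩
        · rintro ⟨_, h⟩; exact ⟨h ▸ hl, h⟩
      · refine ⟨∅, @MeasurableSet.empty X m, ?_⟩
        ext x
        simp only [Set.mem_inter_iff, Set.mem_preimage, Set.mem_singleton_iff,
          Set.mem_empty_iff_false, false_and, iff_false]
        rintro ⟨h1, h⟩; exact hl (h ▸ h1)
    · exact ⟨t, ht, rfl⟩
  | empty => exact ⟨∅, @MeasurableSet.empty X m, rfl⟩
  | compl t _ ih =>
    obtain ⟨e, he, h⟩ := ih
    refine ⟨eᶜ, @MeasurableSet.compl X e m he, ?_⟩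
    ext x
    have := Set.ext_iff.1 h x
    simp only [Set.mem_inter_iff, Set.mem_compl_iff] at this ⊢
    tauto
  | iUnion f _ ih =>
    choose e he h using ih
    refine ⟨⋃ i, e i, @MeasurableSet.iUnion X ℕ m _ _ he, ?_⟩
    rw [Set.iUnion_inter, Set.iUnion_inter]
    exact Set.iUnion_congr h

lemma chain_ae {q : X → L} (hm : m ≤ mX) (hq : sAlg q ≤ mX) (l : L) {A : Set X}
    (hA : MeasurableSet A) :
    ∀ᵐ x ∂μ, x ∈ q ⁻¹' {l} → μ[ind (q ⁻¹' {l} ∩ A) | m] x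
      = μ[ind A | sAlg q ⊔ m] x * μ[ind (q ⁻¹' {l}) | m] x := by
  have hm' : sAlg q ⊔ m ≤ mX := sup_le hq hm
  set B := q ⁻¹' {l} with hB
  have hBm' : MeasurableSet[sAlg q ⊔ m] B :=
    (le_sup_left : sAlg q ≤ sAlg q ⊔ m) _ ⟨{l}, trivial, rfl⟩
  have hBX : MeasurableSet B := hm' _ hBm'
  have hBA := hBX.inter hA
  have hbd := condExp_ind_bdd (μ := μ) hBX hm
  have hYs : StronglyMeasurable[m] (μ[ind B | m]) := stronglyMeasurable_condExp
  have hi : Integrable (ind (B ∩ A) * μ[ind B | m]) μ := by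
    rw [ind_mul_eq]; exact integrable_condExp.indicator hBA
  have h1 : B.indicator (μ[ind (B ∩ A) | m]) =ᵐ[μ] μ[ind (B ∩ A) * μ[ind B | m] | sAlg q ⊔ m] := by
    refine ae_eq_condExp_of_forall_setIntegral_eq hm' hi
      (fun s _ _ => (integrable_condExp.indicator hBX).integrableOn) ?_ ?_
    · intro s hs _
      obtain ⟨e, he, hse⟩ := trace_sup l hs
      rw [setIntegral_indicator hBX, hse,
        setIntegral_pull hm hBX he stronglyMeasurable_condExp integrable_condExp]
      rw [ind_mul_eq, setIntegral_indicator hBA]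
      have : s ∩ (B ∩ A) = e ∩ (B ∩ A) := by
        rw [← Set.inter_assoc, ← Set.inter_assoc, hse]
      rw [this, setIntegral_pull hm hBA he stronglyMeasurable_condExp integrable_condExp]
      simp_rw [mul_comm]
    · exact ((stronglyMeasurable_condExp.mono le_sup_right).indicator hBm').aestronglyMeasurable
  have h2 := condExp_mul_of_stronglyMeasurable_right (μ := μ) (m := sAlg q ⊔ m) (f := ind (B ∩ A))
    (hYs.mono le_sup_right) hi (integrable_ind hBA)
  have h3 : μ[ind (B ∩ A) | sAlg q ⊔ m] =ᵐ[μ] B.indicator (μ[ind A | sAlg q ⊔ m]) := by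
    have : ind (B ∩ A) = B.indicator (ind A) := by
      rw [ind, ind, Set.indicator_indicator]
    rw [this]
    exact condExp_indicator (integrable_ind hA) hBm'
  filter_upwards [h1, h2, h3] with x h1 h2 h3 hx
  rw [Set.indicator_of_mem hx] at h1 h3
  rw [h1, h2, Pi.mul_apply, h3]

lemma condExp_ind_pos {A : Set X} (hA : MeasurableSet A) (hm : m ≤ mX) :
    ∀ᵐ x ∂μ, x ∈ A → 0 < μ[ind A | m] x := by
  set s : Set X := {x | μ[ind A | m] x ≤ 0} with hs
  have hsm : MeasurableSet[m] s := by
    have h : MeasurableSet[m] ((μ[ind A | m]) ⁻¹' Set.Iic 0) :=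
      (stronglyMeasurable_condExp (m := m) (μ := μ) (f := ind A)).measurable measurableSet_Iic
    exact h
  have h1 : ∫ x in s, μ[ind A | m] x ∂μ ≤ 0 :=
    setIntegral_nonpos (hm _ hsm) fun x hx => hx
  rw [setIntegral_condExp hm (integrable_ind hA) hsm, setIntegral_indicator hA] at h1
  simp only [integral_const, smul_eq_mul, mul_one, measureReal_restrict_apply_univ] at h1
  have h2 : μ (s ∩ A) = 0 := by
    have := le_antisymm h1 measureReal_nonneg
    rwa [measureReal_eq_zero_iff] at this
  rw [ae_iff]
  convert h2 using 2
  ext x; simp [hs, and_comm]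

lemma HpartC_chain [Countable K] [Countable L] {p : X → K} {q : X → L}
    (hp : ∀ k, MeasurableSet (p ⁻¹' {k})) (hq : ∀ k, MeasurableSet (q ⁻¹' {k}))
    (hqs : sAlg q ≤ mX) (hm : m ≤ mX) :
    HpartC μ (pjoin q p) m = HpartC μ q m + HpartC μ p (sAlg q ⊔ m) := by
  have hm' : sAlg q ⊔ m ≤ mX := sup_le hqs hm
  rw [HpartC_eq_lintegral, HpartC_eq_lintegral, HpartC_eq_lintegral, ← lintegral_add_left]
  swap
  · exact measurable_glue hq (g := fun l => info μ (q ⁻¹' {l}) m)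
      fun l => (measurable_info _ hm).mono hm le_rfl
  refine lintegral_congr_ae ?_
  have a1 := ae_all_iff.2 fun l : L => ae_all_iff.2 fun k : K =>
    chain_ae (μ := μ) (q := q) hm hqs l (hp k)
  have a2 := ae_all_iff.2 fun l : L => condExp_ind_pos (μ := μ) (hq l) hm
  have a3 := ae_all_iff.2 fun k : K => condExp_ind_pos (μ := μ) (hp k) hm'
  have a4 := ae_all_iff.2 fun l : L => condExp_ind_bdd (μ := μ) (hq l) hm
  have a5 := ae_all_iff.2 fun k : K => condExp_ind_bdd (μ := μ) (hp k) hm'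
  filter_upwards [a1, a2, a3, a4, a5] with x a1 a2 a3 a4 a5
  have hs : pjoin q p ⁻¹' {pjoin q p x} = q ⁻¹' {q x} ∩ p ⁻¹' {p x} := by
    ext y; simp [pjoin]
  simp only [info, hs]
  have p2 := a2 (q x) rfl
  have p3 := a3 (p x) rfl
  rw [a1 (q x) (p x) rfl, Real.log_mul p3.ne' p2.ne', ← ENNReal.ofReal_add]
  · congr 1; ring
  · exact neg_nonneg.2 (Real.log_nonpos p2.le (a4 _).2)
  · exact neg_nonneg.2 (Real.log_nonpos p3.le (a5 _).2)

lemma condExp_comp_mp {S : X → X} (hS : MeasurePreserving S μ μ) (hm : m ≤ mX) {f : X → ℝ}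
    (hf : Integrable f μ) :
    μ[f ∘ S | m.comap S] =ᵐ[μ] μ[f | m] ∘ S := by
  have hle : m.comap S ≤ mX := by
    rintro s ⟨t, ht, rfl⟩; exact hS.measurable (hm _ ht)
  have key : ∀ {g : X → ℝ} {t : Set X}, Integrable g μ → MeasurableSet t →
      ∫ x in S ⁻¹' t, (g ∘ S) x ∂μ = ∫ x in t, g x ∂μ := by
    intro g t hg ht
    have h := setIntegral_map (μ := μ) (g := S) (f := g) ht (by rw [hS.map_eq]; exact hg.1)
      hS.measurable.aemeasurable
    rw [hS.map_eq] at h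
    exact h.symm
  symm
  refine ae_eq_condExp_of_forall_setIntegral_eq hle (hS.integrable_comp_of_integrable hf)
    (fun s _ _ => (hS.integrable_comp_of_integrable integrable_condExp).integrableOn) ?_ ?_
  · rintro s ⟨t, ht, rfl⟩ _
    rw [key integrable_condExp (hm _ ht), key hf (hm _ ht), setIntegral_condExp hm hf ht]
  · refine StronglyMeasurable.aestronglyMeasurable ?_
    exact (stronglyMeasurable_condExp (m := m)).comp_measurable (comap_measurable S)

lemma HpartC_comp_mp [Countable K] {p : X → K} (hp : ∀ k, MeasurableSet (p ⁻¹' {k}))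
    {S : X → X} (hS : MeasurePreserving S μ μ) (hm : m ≤ mX) :
    HpartC μ (fun x => p (S x)) (m.comap S) = HpartC μ p m := by
  have hp' : ∀ k, MeasurableSet ((fun x => p (S x)) ⁻¹' {k}) := fun k => hS.measurable (hp k)
  rw [HpartC_eq_tsum hp, HpartC_eq_tsum hp']
  refine tsum_congr fun k => ?_
  have e : (fun x => p (S x)) ⁻¹' {k} = S ⁻¹' (p ⁻¹' {k}) := rfl
  rw [e, ← hS.setLIntegral_comp_preimage (hp k) ((measurable_info (p ⁻¹' {k}) hm).mono hm le_rfl)]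
  refine lintegral_congr_ae (ae_restrict_of_ae ?_)
  filter_upwards [condExp_comp_mp hS hm (integrable_ind (μ := μ) (hp k))] with x hx
  have : ind (S ⁻¹' (p ⁻¹' {k})) = ind (p ⁻¹' {k}) ∘ S := rfl
  simp only [info, this, hx, Function.comp_apply]

/-- Conditional expectations with respect to a.e. equal factor maps agree. -/
lemma condExp_comap_congr {Z : Type*} [MeasurableSpace Z] {Φ Ψ : X → Z}
    (hΦ : Measurable Φ) (hΨ : Measurable Ψ) (h : Φ =ᵐ[μ] Ψ) {f : X → ℝ} (hf : Integrable f μ) :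
    μ[f | MeasurableSpace.comap Φ inferInstance] =ᵐ[μ]
      μ[f | MeasurableSpace.comap Ψ inferInstance] := by
  refine ae_eq_condExp_of_forall_setIntegral_eq hΨ.comap_le hf
    (fun s _ _ => integrable_condExp.integrableOn) ?_ ?_
  · rintro s ⟨C, hC, rfl⟩ _
    have hset : Ψ ⁻¹' C =ᵐ[μ] Φ ⁻¹' C := by
      filter_upwards [h] with x hx
      change (Ψ x ∈ C) = (Φ x ∈ C)
      rw [hx]
    rw [setIntegral_congr_set hset, setIntegral_congr_set hset,
      setIntegral_condExp hΦ.comap_le hf ⟨C, hC, rfl⟩]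
  · obtain ⟨g, hg, hgeq⟩ := StronglyMeasurable.exists_eq_measurable_comp
      (stronglyMeasurable_condExp (μ := μ) (f := f) (m := MeasurableSpace.comap Φ inferInstance))
    refine ⟨g ∘ Ψ, hg.comp_measurable (comap_measurable Ψ), ?_⟩
    filter_upwards [h] with x hx
    rw [hgeq, Function.comp_apply, Function.comp_apply, hx]

end Entropy

end Part2

section Part3

section Words
variable {r : ℕ}

/-- formal inverse of a letter -/
def iv (a : Fin r × Bool) : Fin r × Bool := (a.1, !a.2)

lemma iv_iv (a : Fin r × Bool) : iv (iv a) = a := by simp [iv]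

lemma gen_eq_mk (a : Fin r × Bool) : gen a = FreeGroup.mk [a] := by
  rcases a with ⟨i, b⟩
  cases b <;> simp [gen, FreeGroup.of, FreeGroup.inv_mk, FreeGroup.invRev]

lemma gen_iv (a : Fin r × Bool) : gen (iv a) = (gen a)⁻¹ := by
  rcases a with ⟨i, b⟩
  cases b <;> simp [gen, iv]

lemma toWord_gen (a : Fin r × Bool) : (gen a).toWord = [a] := by
  rw [gen_eq_mk, FreeGroup.toWord_mk, FreeGroup.reduce_singleton]

lemma toWord_gen_mul (a : Fin r × Bool) (g : FG r) :
    (gen a * g).toWord = a :: g.toWord ∨ g.toWord = iv a :: (gen a * g).toWord := by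
  rw [FreeGroup.toWord_mul, toWord_gen, List.singleton_append, FreeGroup.reduce.cons,
    FreeGroup.reduce_toWord]
  rcases h : g.toWord with _ | ⟨b, l⟩
  · simp
  · simp only
    split_ifs with hb
    · right
      rcases a with ⟨i, c⟩
      rcases b with ⟨j, d⟩
      simp only at hb
      simp [iv, hb.1, hb.2]
    · left; rfl

lemma iv_eq_iff {a b : Fin r × Bool} : iv a = b ↔ a = iv b := by
  constructor
  · rintro rfl; rw [iv_iv]
  · rintro rfl; rw [iv_iv]

lemma invRev_eq (l : List (Fin r × Bool)) : FreeGroup.invRev l = (l.map iv).reverse := rfl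

lemma toWord_mul_gen (a : Fin r × Bool) (g : FG r) :
    (g * gen a).toWord = g.toWord ++ [a] ∨ g.toWord = (g * gen a).toWord ++ [iv a] := by
  have h := toWord_gen_mul (iv a) g⁻¹
  rw [gen_iv, ← mul_inv_rev, FreeGroup.toWord_inv, FreeGroup.toWord_inv, iv_iv] at h
  rcases h with h | h
  · left
    apply_fun FreeGroup.invRev at h
    rw [FreeGroup.invRev_invRev] at h
    rw [h]
    have := FreeGroup.invRev_invRev (L₁ := g.toWord)
    rw [invRev_eq] at this ⊢
    simp [this, iv_iv]
  · right
    apply_fun FreeGroup.invRev at h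
    rw [FreeGroup.invRev_invRev] at h
    rw [h]
    have := FreeGroup.invRev_invRev (L₁ := (g * gen a).toWord)
    rw [invRev_eq] at this ⊢
    simp [this]

lemma not_iv_last {g : FG r} {a : Fin r × Bool} (h1 : (g * gen a).toWord = g.toWord ++ [a]) :
    ¬ [iv a] <:+ g.toWord := by
  rintro ⟨u, hu⟩
  rcases toWord_mul_gen (iv a) (g * gen a) with h | h
  · rw [gen_iv, mul_inv_cancel_right, h1] at h
    have := congrArg List.length h
    simp at this
  · have hr : FreeGroup.IsReduced (g * gen a).toWord := FreeGroup.isReduced_toWord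
    rw [h1, ← hu, List.append_assoc, FreeGroup.IsReduced] at hr
    have := List.IsChain.right_of_append hr
    simp [iv] at this

lemma toWord_mul_gen_of_not {g : FG r} {a : Fin r × Bool} (h : ¬ [iv a] <:+ g.toWord) :
    (g * gen a).toWord = g.toWord ++ [a] := by
  rcases toWord_mul_gen a g with h1 | h1
  · exact h1
  · exact absurd ⟨_, h1.symm⟩ h

lemma toWord_mk_of_append {g : FG r} {u v : List (Fin r × Bool)} (h : g.toWord = u ++ v) :
    (FreeGroup.mk u).toWord = u ∧ (FreeGroup.mk v).toWord = v := by
  have hr : FreeGroup.IsReduced g.toWord := FreeGroup.isReduced_toWord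
  rw [h] at hr
  have h1 : FreeGroup.IsReduced u := List.IsChain.left_of_append hr
  have h2 : FreeGroup.IsReduced v := List.IsChain.right_of_append hr
  exact ⟨by rw [FreeGroup.toWord_mk, h1.reduce_eq], by rw [FreeGroup.toWord_mk, h2.reduce_eq]⟩

lemma eq_mul_of_append {g : FG r} {u v : List (Fin r × Bool)} (h : g.toWord = u ++ v) :
    g = FreeGroup.mk u * FreeGroup.mk v := by
  rw [← FreeGroup.mk_toWord (x := g), h, FreeGroup.mul_mk]

/-- Parent: `t` is the parent of `g` with letter `x`. -/
def Par (g t : FG r) (x : Fin r × Bool) : Prop := g.toWord = x :: t.toWord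

lemma Par.eq {g t : FG r} {x : Fin r × Bool} (h : Par g t x) : g = gen x * t := by
  have := eq_mul_of_append (u := [x]) (v := t.toWord) h
  rwa [FreeGroup.mk_toWord, ← gen_eq_mk] at this

lemma exists_par {g : FG r} (h : g ≠ 1) : ∃ t x, Par g t x := by
  rcases hg : g.toWord with _ | ⟨x, l⟩
  · exact absurd (FreeGroup.toWord_eq_nil_iff.1 hg) h
  · refine ⟨FreeGroup.mk l, x, ?_⟩
    rw [Par, hg, (toWord_mk_of_append (u := [x]) (v := l) hg).2]

lemma exists_par_of_cons {g : FG r} {x : Fin r × Bool} {l} (h : g.toWord = x :: l) :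
    ∃ t, Par g t x ∧ t.toWord = l := by
  refine ⟨FreeGroup.mk l, ?_, (toWord_mk_of_append (u := [x]) (v := l) h).2⟩
  rw [Par, h, (toWord_mk_of_append (u := [x]) (v := l) h).2]

lemma Par.norm {g t : FG r} {x : Fin r × Bool} (h : Par g t x) : g.norm = t.norm + 1 := by
  rw [FreeGroup.norm, FreeGroup.norm, h]; simp

lemma Par.unique {g t t' : FG r} {x x' : Fin r × Bool} (h : Par g t x) (h' : Par g t' x') :
    t = t' ∧ x = x' := by
  rw [Par] at h h'
  rw [h] at h'
  simp only [List.cons.injEq] at h'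
  exact ⟨FreeGroup.toWord_injective h'.2, h'.1⟩

/-- descendants of `g` in the rooted tree -/
def Desc (g : FG r) : Set (FG r) := {f | g.toWord <:+ f.toWord}

lemma Desc.par_mem {g t g' t' : FG r} {x x'} (h : Par g t x) (h' : Par g' t' x')
    (hd : g' ∈ Desc g) : t' ∈ Desc g ∨ (g' = g ∧ t' = t ∧ x' = x) := by
  have hd' : g.toWord <:+ g'.toWord := hd
  rw [h', List.suffix_cons_iff] at hd'
  rcases hd' with h1 | h1
  · right
    have : g' = g := FreeGroup.toWord_injective (by rw [h', h1])
    subst this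
    exact ⟨rfl, h'.unique h⟩
  · left; exact h1

lemma norm_le_of_desc {g f : FG r} (h : f ∈ Desc g) : g.norm ≤ f.norm := List.IsSuffix.length_le h

lemma self_mem_desc (g : FG r) : g ∈ Desc g := List.suffix_rfl

lemma par_not_mem_desc {g t : FG r} {x} (h : Par g t x) : t ∉ Desc g := by
  intro hd
  have := norm_le_of_desc hd
  have := h.norm
  omega

/-- an edge of the Cayley graph entering `Desc g` goes from the parent to `g`. -/
lemma adjL_enter {g t a b : FG r} {x} (h : Par g t x) (hab : adjL a b) (ha : a ∉ Desc g)
    (hb : b ∈ Desc g) : a = t := by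
  obtain ⟨s, ⟨y, rfl⟩, rfl⟩ := hab
  rcases toWord_gen_mul y a with h1 | h1
  · rcases Desc.par_mem h (show Par (gen y * a) a y from h1) hb with h2 | h2
    · exact absurd h2 ha
    · exact h2.2.1
  · exfalso
    apply ha
    have hb' : g.toWord <:+ (gen y * a).toWord := hb
    show g.toWord <:+ a.toWord
    rw [h1]
    exact hb'.trans (List.suffix_cons _ _)

lemma mem_past_aux {g t : FG r} {x} (h : Par g t x) (l : List (FG r)) :
    ∀ f, l.head? = some f → f ∉ Desc g → l.getLast? = some g → l.IsChain adjL → t ∈ l := by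
  induction l with
  | nil => intro f hf; simp at hf
  | cons a l ih =>
    intro f hf hfd hl hc
    simp only [List.head?_cons, Option.some.injEq] at hf
    subst hf
    rcases l with _ | ⟨b, l⟩
    · simp only [List.getLast?_singleton, Option.some.injEq] at hl
      exact absurd (hl ▸ self_mem_desc g) hfd
    · rw [List.isChain_cons_cons] at hc
      by_cases hb : b ∈ Desc g
      · rw [adjL_enter h hc.1 hfd hb]; simp
      · exact List.mem_cons_of_mem _ (ih b rfl hb (by simpa using hl) hc.2)

lemma mem_past {g t f : FG r} {x} (h : Par g t x) (hf : f ∉ Desc g) : f ∈ Past g t := by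
  intro l _ h1 h2 h3
  exact mem_past_aux h l f h1 hf h2 h3

lemma ball_finite (r n : ℕ) : (ball r n).Finite := by
  have : Set.InjOn (FreeGroup.toWord (α := Fin r)) (ball r n) :=
    FreeGroup.toWord_injective.injOn
  refine Set.Finite.of_finite_image ?_ this
  refine (List.finite_length_le (Fin r × Bool) n).subset ?_
  rintro _ ⟨g, hg, rfl⟩
  exact hg

end Words

end Part3

section Part4

section Counting
variable {r : ℕ}

/-- ball as a finset -/
def ballF (r n : ℕ) : Finset (FG r) := (ball_finite r n).toFinset

lemma mem_ballF {n : ℕ} {g : FG r} : g ∈ ballF r n ↔ g.norm ≤ n := by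
  simp [ballF, ball]

/-- sphere as a finset -/
def sphF (r n : ℕ) : Finset (FG r) := (ballF r n).filter (fun g => g.norm = n)

lemma mem_sphF {n : ℕ} {g : FG r} : g ∈ sphF r n ↔ g.norm = n := by
  simp only [sphF, Finset.mem_filter, mem_ballF]
  constructor
  · exact fun h => h.2
  · intro h; exact ⟨h.le, h⟩

open Classical in
/-- elements of the sphere of radius `n + j` whose word ends with `j` copies of `a`. -/
def Rset (r n j : ℕ) (a : Fin r × Bool) : Finset (FG r) :=
  (sphF r (n + j)).filter (fun g => List.replicate j a <:+ g.toWord)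

lemma mem_Rset {n j : ℕ} {a : Fin r × Bool} {g : FG r} :
    g ∈ Rset r n j a ↔ g.norm = n + j ∧ List.replicate j a <:+ g.toWord := by
  simp [Rset, mem_sphF]

open Classical in
/-- the union of the translates `B_n a^i`, `i ≤ m`. -/
def Qset (r n : ℕ) (a : Fin r × Bool) : ℕ → Finset (FG r)
  | 0 => ballF r n
  | m + 1 => Qset r n a m ∪ Rset r n (m + 1) a

lemma mem_Qset {n m : ℕ} {a : Fin r × Bool} {g : FG r} :
    g ∈ Qset r n a m ↔ g.norm ≤ n ∨ ∃ j, 1 ≤ j ∧ j ≤ m ∧ g.norm = n + j ∧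
      List.replicate j a <:+ g.toWord := by
  induction m with
  | zero =>
    rw [Qset, mem_ballF]
    constructor
    · exact Or.inl
    · rintro (h | ⟨j, h1, h2, -⟩)
      · exact h
      · omega
  | succ m ih =>
    rw [Qset, Finset.mem_union, ih, mem_Rset]
    constructor
    · rintro ((h | ⟨j, h1, h2, h3⟩) | h)
      · exact Or.inl h
      · exact Or.inr ⟨j, h1, by omega, h3⟩
      · exact Or.inr ⟨m + 1, by omega, le_rfl, h⟩
    · rintro (h | ⟨j, h1, h2, h3⟩)
      · exact Or.inl (Or.inl h)
      · rcases Nat.lt_or_ge m j with hj | hj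
        · obtain rfl : j = m + 1 := by omega
          exact Or.inr h3
        · exact Or.inl (Or.inr ⟨j, h1, hj, h3⟩)

lemma replicate_succ_suffix {a : Fin r × Bool} {j : ℕ} {l : List (Fin r × Bool)}
    (h : List.replicate (j + 1) a <:+ l) : [a] <:+ l := by
  refine List.IsSuffix.trans ?_ h
  rw [List.replicate_succ']
  exact List.suffix_append _ _

lemma mul_gen_word_of_last {g : FG r} {a : Fin r × Bool} (h : [a] <:+ g.toWord) :
    (g * gen a).toWord = g.toWord ++ [a] := by
  apply toWord_mul_gen_of_not
  intro h2
  obtain ⟨u, hu⟩ := h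
  obtain ⟨v, hv⟩ := h2
  have := hu.trans hv.symm
  have := List.append_inj_right' this rfl
  simp [iv, Prod.ext_iff] at this

lemma norm_mul_gen_of_word {g : FG r} {a : Fin r × Bool}
    (h : (g * gen a).toWord = g.toWord ++ [a]) : (g * gen a).norm = g.norm + 1 := by
  simp [FreeGroup.norm, h]

lemma mul_gen_mem_Rset {n j : ℕ} {a : Fin r × Bool} {g : FG r} (h : g ∈ Rset r n (j + 1) a) :
    g * gen a ∈ Rset r n (j + 1 + 1) a ∧ (g * gen a).toWord = g.toWord ++ [a] := by
  rw [mem_Rset] at h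
  have hw := mul_gen_word_of_last (replicate_succ_suffix h.2)
  refine ⟨?_, hw⟩
  rw [mem_Rset, norm_mul_gen_of_word hw, hw, h.1]
  refine ⟨by omega, ?_⟩
  rw [List.replicate_succ' (n := j + 1)]
  obtain ⟨u, hu⟩ := h.2
  exact ⟨u, by rw [← hu, List.append_assoc]⟩

lemma mem_Qset_iff {n m : ℕ} {a : Fin r × Bool} {g : FG r} :
    g ∈ Qset r n a m ↔ ∃ i, i ≤ m ∧ (g * (gen a ^ i)⁻¹).norm ≤ n := by
  constructor
  · rw [mem_Qset]
    rintro (h | ⟨j, h1, h2, h3, u, hu⟩)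
    · exact ⟨0, by omega, by simpa using h⟩
    · refine ⟨j, h2, ?_⟩
      have h4 := eq_mul_of_append hu.symm
      have h5 : FreeGroup.mk (List.replicate j a) = gen a ^ j := by
        clear h4 hu h3 h1 h2
        induction j with
        | zero => rfl
        | succ j ih =>
          rw [List.replicate_succ, pow_succ', ← ih, gen_eq_mk, FreeGroup.mul_mk]; rfl
      rw [h5] at h4
      have h6 : g * (gen a ^ j)⁻¹ = FreeGroup.mk u := by
        rw [mul_inv_eq_iff_eq_mul]; exact h4
      rw [h6]
      refine FreeGroup.norm_mk_le.trans ?_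
      have := congrArg List.length hu
      simp only [List.length_append, List.length_replicate] at this
      have h7 : g.norm = g.toWord.length := rfl
      omega
  · rintro ⟨i, hi, h⟩
    induction i generalizing g m with
    | zero => rw [mem_Qset]; left; simpa using h
    | succ i ih =>
      obtain ⟨m, rfl⟩ : ∃ k, m = k + 1 := ⟨m - 1, by omega⟩
      have h1 : g * (gen a)⁻¹ ∈ Qset r n a m := by
        apply ih (by omega)
        rw [pow_succ, mul_inv_rev, ← mul_assoc] at h
        exact h
      obtain ⟨g', rfl⟩ : ∃ g', g = g' * gen a := ⟨g * (gen a)⁻¹, by simp⟩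
      rw [mul_inv_cancel_right] at h1
      rw [mem_Qset] at h1 ⊢
      rcases h1 with h1 | ⟨j, h1, h2, h3⟩
      · rcases toWord_mul_gen a g' with hw | hw
        · have := norm_mul_gen_of_word hw
          rcases Nat.lt_or_ge n ((g' * gen a).norm) with h4 | h4
          · exact Or.inr ⟨1, le_rfl, by omega, by omega, by rw [hw]; exact List.suffix_append _ _⟩
          · exact Or.inl h4
        · left
          have : g'.norm = (g' * gen a).norm + 1 := by
            have := congrArg List.length hw
            simpa [FreeGroup.norm] using this
          omega
      · obtain ⟨j, rfl⟩ : ∃ k, j = k + 1 := ⟨j - 1, by omega⟩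
        have := (mul_gen_mem_Rset (mem_Rset.2 h3)).1
        exact Or.inr ⟨j + 1 + 1, by omega, by omega, mem_Rset.1 this⟩

/-- tail closed -/
def TailClosed (Q : Finset (FG r)) : Prop :=
  1 ∈ Q ∧ ∀ g t x, Par g t x → g ∈ Q → t ∈ Q

lemma tailClosed_Qset (n m : ℕ) (a : Fin r × Bool) : TailClosed (Qset r n a m) := by
  constructor
  · rw [mem_Qset]; left; simp
  · intro g t x h hg
    have hn := h.norm
    rw [mem_Qset] at hg ⊢
    rcases hg with hg | ⟨j, h1, h2, h3, h4⟩
    · left; omega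
    · obtain ⟨j, rfl⟩ : ∃ k, j = k + 1 := ⟨j - 1, by omega⟩
      rcases Nat.eq_zero_or_pos j with rfl | hj
      · left; omega
      · right
        refine ⟨j, hj, by omega, by omega, ?_⟩
        rw [h, List.suffix_cons_iff, List.replicate_succ] at h4
        rcases h4 with h4 | h4
        · simp only [List.cons.injEq] at h4
          rw [h4.2]
        · exact (List.suffix_cons _ _).trans h4

variable (ω : Option (Fin r × Bool) → ℝ)

/-- weight of a group element -/
def wt (g : FG r) : ℝ := ω g.toWord.head?

lemma wt_mul_gen {g : FG r} {a} (hg : 1 ≤ g.norm) (h : (g * gen a).toWord = g.toWord ++ [a]) :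
    wt ω (g * gen a) = wt ω g := by
  rw [wt, wt, h]
  have h7 : g.norm = g.toWord.length := rfl
  rcases hw : g.toWord with _ | ⟨y, l⟩
  · rw [hw, List.length_nil] at h7; omega
  · rfl

lemma Rset_sum_succ (n j : ℕ) (a : Fin r × Bool) :
    ∑ g ∈ Rset r n (j + 1 + 1) a, wt ω g = ∑ g ∈ Rset r n (j + 1) a, wt ω g := by
  symm
  refine Finset.sum_bij (fun g _ => g * gen a) ?_ ?_ ?_ ?_
  · intro g hg; exact (mul_gen_mem_Rset hg).1
  · intro g _ g' _ h; exact mul_right_cancel h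
  · intro g hg
    rw [mem_Rset] at hg
    obtain ⟨u, hu⟩ := hg.2
    rw [List.replicate_succ', ← List.append_assoc] at hu
    have h1 := toWord_mk_of_append hu.symm
    have h2 := eq_mul_of_append hu.symm
    rw [← gen_eq_mk] at h2
    refine ⟨_, ?_, h2.symm⟩
    rw [mem_Rset, h1.1]
    refine ⟨?_, List.suffix_append _ _⟩
    rw [FreeGroup.norm, h1.1]
    have h3 := hg.1
    rw [FreeGroup.norm, ← hu] at h3
    simp at h3 ⊢
    omega
  · intro g hg
    symm
    apply wt_mul_gen ω _ (mul_gen_mem_Rset hg).2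
    have := (mem_Rset.1 hg).1
    omega

/-- sum over elements of the sphere whose word ends in `a` -/
def Ssum (k : ℕ) (a : Fin r × Bool) : ℝ := ∑ g ∈ Rset r k 1 a, wt ω g

lemma Rset_sum (n j : ℕ) (a : Fin r × Bool) :
    ∑ g ∈ Rset r n (j + 1) a, wt ω g = Ssum ω n a := by
  induction j with
  | zero => rfl
  | succ j ih => rw [Rset_sum_succ, ih]

lemma Qset_sum (n m : ℕ) (a : Fin r × Bool) :
    ∑ g ∈ Qset r n a m, wt ω g = ∑ g ∈ ballF r n, wt ω g + m * Ssum ω n a := by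
  induction m with
  | zero => simp [Qset]
  | succ m ih =>
    rw [Qset, Finset.sum_union, ih, Rset_sum]
    · push_cast; ring
    · rw [Finset.disjoint_left]
      intro g hg hg'
      rw [mem_Qset] at hg
      rw [mem_Rset] at hg'
      rcases hg with hg | ⟨j, h1, h2, h3, h4⟩ <;> omega

lemma ballF_sum_succ (n : ℕ) :
    ∑ g ∈ ballF r (n + 1), wt ω g
      = ∑ g ∈ ballF r n, wt ω g + ∑ a : Fin r × Bool, Ssum ω n a := by
  classical
  have h1 : ballF r (n + 1) = ballF r n ∪ Finset.univ.biUnion (fun a => Rset r n 1 a) := by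
    ext g
    simp only [Finset.mem_union, Finset.mem_biUnion, Finset.mem_univ, true_and, mem_ballF,
      mem_Rset]
    constructor
    · intro h
      rcases Nat.lt_or_ge n g.norm with h2 | h2
      · right
        have h7 : g.norm = g.toWord.length := rfl
        rcases List.eq_nil_or_concat g.toWord with h3 | ⟨u, a, h3⟩
        · rw [h3, List.length_nil] at h7; omega
        · refine ⟨a, by omega, u, ?_⟩
          rw [h3]; simp
      · exact Or.inl h2
    · rintro (h | ⟨a, h, -⟩) <;> omega
  rw [h1, Finset.sum_union, Finset.sum_biUnion]
  · rfl
  · intro a _ b _ hab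
    rw [Function.onFun, Finset.disjoint_left]
    intro g hg hg'
    obtain ⟨u, hu⟩ := (mem_Rset.1 hg).2
    obtain ⟨v, hv⟩ := (mem_Rset.1 hg').2
    have := List.append_inj_right' (hu.trans hv.symm) rfl
    simp at this
    exact hab this
  · rw [Finset.disjoint_left]
    intro g hg
    rw [mem_ballF] at hg
    simp only [Finset.mem_biUnion, not_exists, mem_Rset]
    rintro a ⟨-, h, -⟩
    omega

lemma Ssum_succ (n : ℕ) (a : Fin r × Bool) :
    Ssum ω (n + 1) a + Ssum ω n (iv a) = ∑ b : Fin r × Bool, Ssum ω n b := by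
  classical
  -- the sphere of radius n+1
  have h0 : ∑ g ∈ sphF r (n + 1), wt ω g = ∑ b : Fin r × Bool, Ssum ω n b := by
    have h1 := ballF_sum_succ ω n
    have h2 : ballF r (n + 1) = ballF r n ∪ sphF r (n + 1) := by
      ext g; simp only [Finset.mem_union, mem_ballF, mem_sphF]; omega
    rw [h2, Finset.sum_union] at h1
    · linarith
    · rw [Finset.disjoint_left]; intro g; rw [mem_ballF, mem_sphF]; omega
  rw [← h0, ← Finset.sum_filter_not_add_sum_filter (s := sphF r (n + 1))
    (p := fun g => List.replicate 1 (iv a) <:+ g.toWord)]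
  congr 1
  rw [Ssum]
  symm
  refine Finset.sum_bij (fun g _ => g * gen a) ?_ ?_ ?_ ?_
  · intro g hg
    rw [Finset.mem_filter, mem_sphF] at hg
    have hw := toWord_mul_gen_of_not hg.2
    rw [mem_Rset, norm_mul_gen_of_word hw, hw, hg.1]
    exact ⟨rfl, List.suffix_append _ _⟩
  · intro g _ g' _ h; exact mul_right_cancel h
  · intro g hg
    rw [mem_Rset] at hg
    obtain ⟨u, hu⟩ := hg.2
    have h1 := toWord_mk_of_append hu.symm
    have h2 := eq_mul_of_append hu.symm
    rw [show List.replicate 1 a = [a] from rfl, ← gen_eq_mk] at h2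
    refine ⟨_, ?_, h2.symm⟩
    rw [Finset.mem_filter, mem_sphF]
    constructor
    · rw [FreeGroup.norm, h1.1]
      have h3 := hg.1
      rw [FreeGroup.norm, ← hu] at h3
      simp at h3 ⊢
      omega
    · apply not_iv_last
      rw [← h2, h1.1]
      exact hu.symm
  · intro g hg
    rw [Finset.mem_filter, mem_sphF] at hg
    symm
    exact wt_mul_gen ω (by omega) (toWord_mul_gen_of_not hg.2)

lemma count_const (n : ℕ) :
    (1 - (r : ℝ)) * ∑ g ∈ ballF r n, wt ω g + ∑ i : Fin r, Ssum ω n (i, true)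
     = (1 - (r : ℝ)) * ∑ g ∈ ballF r 0, wt ω g + ∑ i : Fin r, Ssum ω 0 (i, true) := by
  induction n with
  | zero => rfl
  | succ n ih =>
    rw [← ih, ballF_sum_succ]
    have h : ∀ i : Fin r, Ssum ω (n + 1) (i, true)
        = ∑ b : Fin r × Bool, Ssum ω n b - Ssum ω n (i, false) := by
      intro i
      have := Ssum_succ ω n (i, true)
      simp only [iv, Bool.not_true] at this
      linarith
    simp_rw [h]
    rw [Finset.sum_sub_distrib, Finset.sum_const, Finset.card_univ, Fintype.card_fin, nsmul_eq_mul]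
    have h2 : ∑ b : Fin r × Bool, Ssum ω n b
        = ∑ i : Fin r, Ssum ω n (i, true) + ∑ i : Fin r, Ssum ω n (i, false) := by
      rw [Fintype.sum_prod_type, ← Finset.sum_add_distrib]
      simp
    rw [h2]; ring

lemma Ssum_nonneg (hω : ∀ o, 0 ≤ ω o) (n : ℕ) (a : Fin r × Bool) : 0 ≤ Ssum ω n a :=
  Finset.sum_nonneg fun _ _ => hω _

lemma ballF_zero : ballF r 0 = {1} := by
  ext g; rw [mem_ballF]; simp [FreeGroup.norm_eq_zero]

lemma Ssum_zero (a : Fin r × Bool) : Ssum ω 0 a = ω (some a) := by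
  have : Rset r 0 1 a = {gen a} := by
    ext g
    rw [mem_Rset, Finset.mem_singleton]
    constructor
    · rintro ⟨h1, h2⟩
      have := h2.eq_of_length (by
        have h1' : g.toWord.length = 0 + 1 := h1
        rw [List.length_replicate]; omega)
      apply FreeGroup.toWord_injective
      rw [← this, toWord_gen]; rfl
    · rintro rfl
      simp [FreeGroup.norm, toWord_gen]
  rw [Ssum, this, Finset.sum_singleton, wt, toWord_gen]; rfl

lemma Ssum_le (hω : ∀ o, 0 ≤ ω o) (h : ∀ a, ω (some a) ≤ ω none) (n : ℕ) (a : Fin r × Bool) :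
    Ssum ω n a ≤ ∑ g ∈ ballF r n, wt ω g := by
  rcases n with _ | n
  · rw [Ssum_zero, ballF_zero, Finset.sum_singleton]
    simpa [wt] using h a
  · have h1 := Ssum_succ ω n a
    have h2 := ballF_sum_succ ω n
    have h3 := Ssum_nonneg ω hω n (iv a)
    have h4 : 0 ≤ ∑ g ∈ ballF r n, wt ω g := Finset.sum_nonneg fun _ _ => hω _
    linarith

end Counting

end Part4

section Part5

section MarkovCond
variable {r : ℕ} {X : Type*} [mX : MeasurableSpace X] {μ : Measure X} [IsProbabilityMeasure μ]
  {T : FG r → X → X} {α : X → ℕ}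

lemma sAlg_le {p : X → ℕ} (hp : Measurable p) : sAlg p ≤ mX := by
  rw [sAlg]; exact hp.comap_le

lemma sAlgSet_le (hT : ∀ g, Measurable (T g)) (hα : Measurable α) (Q : Set (FG r)) :
    sAlgSet T α Q ≤ mX :=
  iSup₂_le fun g _ => sAlg_le (hα.comp (hT g))

lemma sAlgG_le (hT : ∀ g, Measurable (T g)) (hα : Measurable α) :
    sAlgG T α ≤ mX :=
  iSup_le fun g => sAlg_le (hα.comp (hT g))

lemma sAlgSet_mono {Q R : Set (FG r)} (h : Q ⊆ R) : sAlgSet T α Q ≤ sAlgSet T α R :=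
  biSup_mono h

lemma le_sAlgSet {Q : Set (FG r)} {g} (h : g ∈ Q) : sAlg (pull T g α) ≤ sAlgSet T α Q :=
  le_biSup (fun g => sAlg (pull T g α)) h

lemma sAlgSet_insert (Q : Set (FG r)) (g : FG r) :
    sAlgSet T α (insert g Q) = sAlg (pull T g α) ⊔ sAlgSet T α Q := by
  rw [sAlgSet, iSup_insert]; rfl

lemma measurableSet_pull (hT : ∀ g, Measurable (T g)) (hα : Measurable α) (g : FG r) (k : ℕ) :
    MeasurableSet (pull T g α ⁻¹' {k}) :=
  (hα.comp (hT g)) (measurableSet_singleton k)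

lemma markov_finite (hT : ∀ g, Measurable (T g)) (hα : Measurable α) (hM : IsMarkov μ T α)
    {g t : FG r} {x} (hg : Par g t x) {p : Set X}
    (hp : MeasurableSet[sAlgSet T α (Desc g)ᶜ] p) (R : Finset (FG r)) :
    (∀ g' ∈ R, g' ∈ Desc g ∧ ∀ t' x', Par g' t' x' → t' ∈ R ∨ t' = t) →
    μ[ind p | sAlg (pull T t α) ⊔ sAlgSet T α R] =ᵐ[μ] μ[ind p | sAlg (pull T t α)] := by
  classical
  induction R using Finset.induction_on_max_value (fun g : FG r => g.norm) with
  | empty => intro _; simp [sAlgSet]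
  | insert g' s hg's hmax ih =>
    intro hR
    have hih := ih (fun a ha => ⟨(hR a (Finset.mem_insert_of_mem ha)).1, fun t' x' h => by
      rcases (hR a (Finset.mem_insert_of_mem ha)).2 t' x' h with h1 | h1
      · rw [Finset.mem_insert] at h1
        rcases h1 with h1 | h1
        · exfalso
          have h2 := hmax a ha
          have h3 := h.norm
          rw [h1] at h3
          omega
        · exact Or.inl h1
      · exact Or.inr h1⟩)
    obtain ⟨hd, hpar⟩ := hR g' (Finset.mem_insert_self _ _)
    have hne : g' ≠ 1 := by
      rintro rfl
      have h1 := norm_le_of_desc hd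
      have h2 := hg.norm
      rw [FreeGroup.norm_one] at h1
      omega
    obtain ⟨t', x', h'⟩ := exists_par hne
    have ht' : t' ∈ s ∨ t' = t := by
      rcases hpar t' x' h' with h1 | h1
      · rw [Finset.mem_insert] at h1
        rcases h1 with h1 | h1
        · exfalso
          have h3 := h'.norm
          rw [h1] at h3
          omega
        · exact Or.inl h1
      · exact Or.inr h1
    have hCm : sAlg (pull T t α) ≤ mX := sAlg_le (hα.comp (hT t))
    have hMm : sAlg (pull T t α) ⊔ sAlgSet T α s ≤ mX := sup_le hCm (sAlgSet_le hT hα _)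
    have htD : t ∈ (Desc g)ᶜ := par_not_mem_desc hg
    have hsub : (Desc g)ᶜ ⊆ Past g' t' := by
      intro f hf
      apply mem_past h'
      intro hf'
      exact hf (List.IsSuffix.trans hd hf')
    have hsub2 : (s : Set (FG r)) ⊆ Past g' t' := by
      intro f hf
      apply mem_past h'
      intro hf'
      have h1 : g'.toWord <:+ f.toWord := hf'
      have h2 : g'.toWord = f.toWord := h1.eq_of_length_le (hmax f hf)
      exact hg's (FreeGroup.toWord_injective h2 ▸ hf)
    have hle : (sAlg (pull T t α) ⊔ sAlgSet T α s) ⊔ sAlgSet T α (Desc g)ᶜ ≤ sAlgSet T α (Past g' t') :=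
      sup_le (sup_le (le_sAlgSet (hsub htD)) (sAlgSet_mono hsub2)) (sAlgSet_mono hsub)
    have hge : sAlg (pull T t' α) ≤ sAlg (pull T t α) ⊔ sAlgSet T α s := by
      rcases ht' with h1 | h1
      · exact (le_sAlgSet (T := T) (α := α) (Q := (s : Set (FG r))) h1).trans le_sup_right
      · rw [h1]; exact le_sup_left
    have key : μ[ind p | (sAlg (pull T t α) ⊔ sAlgSet T α s) ⊔ sAlg (pull T g' α)] =ᵐ[μ]
        μ[ind p | sAlg (pull T t α) ⊔ sAlgSet T α s] := by
      refine condIndep_symm_atoms hMm (sAlgSet_le hT hα _) (hα.comp (hT g')) ?_ hp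
      intro k
      have hmk := hM (gen x') ⟨x', rfl⟩ t' k
      rw [← h'.eq] at hmk
      have e1 := condExp_squeeze (hge.trans le_sup_left) hle (sAlgSet_le hT hα _) hmk
      have e2 := condExp_squeeze hge (le_sup_left.trans hle) (sAlgSet_le hT hα _) hmk
      exact e1.trans e2.symm
    rw [Finset.coe_insert, sAlgSet_insert, sup_comm (sAlg (pull T g' α)), ← sup_assoc]
    exact key.trans hih

lemma markov_desc (hT : ∀ g, Measurable (T g)) (hα : Measurable α) (hM : IsMarkov μ T α)
    {g t : FG r} {x} (hg : Par g t x) {p : Set X}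
    (hp : MeasurableSet[sAlgSet T α (Desc g)ᶜ] p) :
    μ[ind p | sAlg (pull T t α) ⊔ sAlgSet T α (Desc g)] =ᵐ[μ] μ[ind p | sAlg (pull T t α)] := by
  classical
  let D : ℕ → Finset (FG r) := fun k => (ballF r k).filter (fun f => f ∈ Desc g)
  have hDmem : ∀ k f, f ∈ D k ↔ f.norm ≤ k ∧ f ∈ Desc g := by
    intro k f; simp [D, mem_ballF]
  have hDmono : Monotone D := by
    intro i j hij f hf
    rw [hDmem] at hf ⊢
    exact ⟨hf.1.trans hij, hf.2⟩
  have hE : sAlgSet T α (Desc g) = ⨆ k, sAlgSet T α (D k) := by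
    apply le_antisymm
    · refine iSup₂_le fun f hf => ?_
      refine le_trans ?_ (le_iSup _ f.norm)
      exact le_sAlgSet (Finset.mem_coe.2 ((hDmem _ _).2 ⟨le_rfl, hf⟩))
    · refine iSup_le fun k => sAlgSet_mono fun f hf => ?_
      exact ((hDmem _ _).1 (Finset.mem_coe.1 hf)).2
  rw [hE]
  refine condIndep_iSup (sAlg_le (hα.comp (hT t)))
    (fun i j hij => sAlgSet_mono (Finset.coe_subset.2 (hDmono hij)))
    (fun k => sAlgSet_le hT hα _) (integrable_ind (sAlgSet_le hT hα _ _ hp)) ?_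
  intro k
  refine markov_finite hT hα hM hg hp (D k) ?_
  intro g' hg'
  rw [hDmem] at hg'
  refine ⟨hg'.2, fun t' x' h => ?_⟩
  rcases Desc.par_mem hg h hg'.2 with h1 | h1
  · left
    rw [hDmem]
    have := h.norm
    exact ⟨by omega, h1⟩
  · exact Or.inr h1.2.1

lemma sAlg_comp_le (b : ℕ → ℕ) (p : X → ℕ) : sAlg (fun x => b (p x)) ≤ sAlg p := by
  rw [sAlg, sAlg]
  rintro _ ⟨s, -, rfl⟩
  exact ⟨b ⁻¹' s, trivial, rfl⟩

lemma markov_given (hT : ∀ g, Measurable (T g)) (hα : Measurable α) (hM : IsMarkov μ T α)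
    (b : ℕ → ℕ) {g t : FG r} {x} (hg : Par g t x) {Q : Set (FG r)} (ht : t ∈ Q)
    (hQ : Q ⊆ (Desc g)ᶜ) (k : ℕ) :
    μ[ind (pull T g α ⁻¹' {k}) | sAlgSet T α Q ⊔ sAlgG T (fun x => b (α x))] =ᵐ[μ]
    μ[ind (pull T g α ⁻¹' {k}) | sAlg (pull T t α) ⊔ sAlgG T (fun x => b (α x))] := by
  set β : X → ℕ := fun x => b (α x)
  have hF : sAlgG T β = sAlgSet T β (Desc g)ᶜ ⊔ sAlgSet T β (Desc g) := by
    apply le_antisymm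
    · refine iSup_le fun f => ?_
      by_cases hf : f ∈ Desc g
      · exact (le_sAlgSet hf).trans le_sup_right
      · exact (le_sAlgSet (Q := (Desc g)ᶜ) hf).trans le_sup_left
    · exact sup_le (iSup₂_le fun f _ => le_iSup (fun g => sAlg (pull T g β)) f)
        (iSup₂_le fun f _ => le_iSup (fun g => sAlg (pull T g β)) f)
  have hco : ∀ R, sAlgSet T β R ≤ sAlgSet T α R := fun R =>
    iSup₂_mono fun f _ => sAlg_comp_le b (pull T f α)
  have htD : t ∈ (Desc g)ᶜ := par_not_mem_desc hg
  have hA : MeasurableSet[sAlgSet T α (Desc g)] (pull T g α ⁻¹' {k}) := by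
    apply le_sAlgSet (T := T) (α := α) (self_mem_desc g)
    exact ⟨{k}, trivial, rfl⟩
  have hind : ∀ p, MeasurableSet[sAlgSet T α (Desc g)ᶜ] p →
    μ[ind p | sAlg (pull T t α) ⊔ sAlgSet T α (Desc g)] =ᵐ[μ] μ[ind p | sAlg (pull T t α)] :=
    fun p hp => markov_desc hT hα hM hg hp
  rw [hF]
  have e1 := markov_cond (μ := μ) (Q := sAlgSet T α Q) (sAlg_le (hα.comp (hT t)))
    (sAlgSet_le hT hα (Desc g)ᶜ) (sAlgSet_le hT hα (Desc g)) (le_sAlgSet htD) (hco (Desc g)ᶜ)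
    (hco (Desc g)) (le_sAlgSet ht) (sAlgSet_mono hQ) hind hA
  have e2 := markov_cond (μ := μ) (Q := sAlg (pull T t α)) (sAlg_le (hα.comp (hT t)))
    (sAlgSet_le hT hα (Desc g)ᶜ) (sAlgSet_le hT hα (Desc g)) (le_sAlgSet htD) (hco (Desc g)ᶜ)
    (hco (Desc g)) le_rfl (le_sAlgSet htD) hind hA
  exact e1.trans e2.symm

end MarkovCond

end Part5

section Entropy
variable {r : ℕ} {X : Type*} [mX : MeasurableSpace X] {μ : Measure X} [IsProbabilityMeasure μ]
  {T : FG r → X → X} {α : X → ℕ}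

lemma sAlgG_eq_comap (p : X → ℕ) :
    sAlgG T p = MeasurableSpace.comap (fun x (g : FG r) => p (T g x)) MeasurableSpace.pi := by
  rw [MeasurableSpace.pi, MeasurableSpace.comap_iSup, sAlgG]
  refine iSup_congr fun g => ?_
  rw [MeasurableSpace.comap_comp]
  rfl

lemma sAlg_powS (Q : Finset (FG r)) : sAlg (powS T α (Q : Set (FG r))) = sAlgSet T α Q := by
  have h : (⊤ : MeasurableSpace (↥(Q : Set (FG r)) → ℕ)) = MeasurableSpace.pi := by
    symm
    rw [eq_top_iff]
    intro s _
    exact Set.Countable.measurableSet (Set.to_countable s)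
  rw [sAlg, h, MeasurableSpace.pi, MeasurableSpace.comap_iSup, sAlgSet, iSup_subtype']
  refine iSup_congr fun g => ?_
  rw [MeasurableSpace.comap_comp]
  rfl

lemma measurable_powS_atom (hT : ∀ g, Measurable (T g)) (hα : Measurable α) (Q : Finset (FG r))
    (k : ↥(Q : Set (FG r)) → ℕ) : MeasurableSet (powS T α (Q : Set (FG r)) ⁻¹' {k}) := by
  apply sAlgSet_le hT hα Q
  rw [← sAlg_powS]
  exact ⟨{k}, trivial, rfl⟩

lemma sAlgG_comap (hTmul : ∀ g h : FG r, T (g * h) = T g ∘ T h) (p : X → ℕ) (t : FG r) :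
    (sAlgG T p).comap (T t) = sAlgG T p := by
  rw [sAlgG, MeasurableSpace.comap_iSup]
  rw [← (Equiv.mulRight t).iSup_comp (g := fun g => sAlg (pull T g p))]
  refine iSup_congr fun g => ?_
  rw [sAlg, MeasurableSpace.comap_comp, sAlg]
  congr 1
  ext x
  simp [pull, hTmul]

variable (μ T α) in
/-- ENNReal weights -/
def wE (F : MeasurableSpace X) (o : Option (Fin r × Bool)) : ℝ≥0∞ :=
  match o with
  | none => HpartC (mX := mX) μ α F
  | some x => HpartC (mX := mX) μ (pull T (gen x) α) (sAlg α ⊔ F)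

lemma entropy_formula (hT1 : T 1 = id) (hTmul : ∀ g h : FG r, T (g * h) = T g ∘ T h)
    (hTmp : ∀ g, MeasurePreserving (T g) μ μ) (hα : Measurable α) (hM : IsMarkov μ T α)
    (b : ℕ → ℕ) (Q : Finset (FG r)) :
    TailClosed Q → HpartC μ (powS T α (Q : Set (FG r))) (sAlgG T (fun x => b (α x)))
      = ∑ g ∈ Q, wE μ T α (sAlgG T (fun x => b (α x))) g.toWord.head? := by
  classical
  have hT : ∀ g, Measurable (T g) := fun g => (hTmp g).measurable
  have hbα : Measurable (fun x => b (α x)) := (measurable_of_countable b).comp hα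
  have hFm : sAlgG T (fun x => b (α x)) ≤ mX := sAlgG_le hT hbα
  induction Q using Finset.induction_on_max_value (fun g : FG r => g.norm) with
  | empty => intro h; exact absurd h.1 (by simp)
  | insert g s hgs hmax ih =>
    intro hQ
    by_cases hg1 : g = 1
    · subst hg1
      have hs : s = ∅ := by
        rw [Finset.eq_empty_iff_forall_notMem]
        intro a ha
        have h1 := hmax a ha
        rw [FreeGroup.norm_one, Nat.le_zero, FreeGroup.norm_eq_zero] at h1
        exact hgs (h1 ▸ ha)
      subst hs
      rw [Finset.sum_insert hgs, Finset.sum_empty, add_zero, FreeGroup.toWord_one]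
      show _ = HpartC μ α _
      apply HpartC_congr_ker
      intro x y
      constructor
      · intro h
        have := congrFun h ⟨1, by simp⟩
        simpa [powS, hT1] using this
      · intro h
        ext ⟨q, hq⟩
        have hq' : q = 1 := by simpa using hq
        subst hq'
        simpa [powS, hT1] using h
    · obtain ⟨t, x, hp⟩ := exists_par hg1
      have hts : t ∈ s := by
        have h1 := hQ.2 g t x hp (Finset.mem_insert_self _ _)
        rw [Finset.mem_insert] at h1
        rcases h1 with h1 | h1
        · have := hp.norm
          rw [h1] at this
          omega
        · exact h1
      have hs : TailClosed s := by
        constructor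
        · have h1 := hQ.1
          rw [Finset.mem_insert] at h1
          exact h1.resolve_left (fun h => hg1 h.symm)
        · intro g' t' x' h' hg'
          have h1 := hQ.2 g' t' x' h' (Finset.mem_insert_of_mem hg')
          rw [Finset.mem_insert] at h1
          refine h1.resolve_left fun h => ?_
          have h2 := hmax g' hg'
          have h3 := h'.norm
          rw [h] at h3
          omega
      have hsub : (s : Set (FG r)) ⊆ (Desc g)ᶜ := by
        intro f hf hf'
        have h1 : g.toWord <:+ f.toWord := hf'
        have h2 : g.toWord = f.toWord := h1.eq_of_length_le (hmax f hf)
        exact hgs (FreeGroup.toWord_injective h2 ▸ hf)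
      rw [Finset.sum_insert hgs, ← ih hs, add_comm]
      have e1 : HpartC μ (powS T α ((insert g s : Finset (FG r)) : Set (FG r)))
          (sAlgG T (fun x => b (α x))) =
          HpartC μ (pjoin (powS T α (s : Set (FG r))) (pull T g α))
            (sAlgG T (fun x => b (α x))) := by
        apply HpartC_congr_ker
        intro y z
        constructor
        · intro h
          refine Prod.ext ?_ ?_
          · ext ⟨q, hq⟩
            exact congrFun h ⟨q, by simp only [Finset.coe_insert]; exact Or.inr hq⟩
          · exact congrFun h ⟨g, by simp⟩
        · intro h
          ext ⟨q, hq⟩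
          rw [Finset.coe_insert] at hq
          rcases hq with rfl | hq
          · exact (Prod.ext_iff.1 h).2
          · exact congrFun (Prod.ext_iff.1 h).1 ⟨q, hq⟩
      rw [e1, HpartC_chain (measurableSet_pull hT hα g) (measurable_powS_atom hT hα s)
        (by rw [sAlg_powS]; exact sAlgSet_le hT hα _) hFm]
      congr 1
      rw [sAlg_powS, HpartC_congr_condExp (measurableSet_pull hT hα g)
        (markov_given hT hα hM b hp hts hsub)]
      have h1 : g.toWord.head? = some x := by rw [hp]; rfl
      rw [h1]
      show _ = HpartC μ (pull T (gen x) α) (sAlg α ⊔ _)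
      rw [← HpartC_comp_mp (measurableSet_pull hT hα (gen x)) (hTmp t)
        (sup_le (sAlg_le hα) hFm), MeasurableSpace.comap_sup, sAlgG_comap hTmul]
      have h2 : (sAlg α).comap (T t) = sAlg (pull T t α) := by
        rw [sAlg, MeasurableSpace.comap_comp]; rfl
      have h3 : (fun y => pull T (gen x) α (T t y)) = pull T g α := by
        ext y
        rw [hp.eq]
        simp [pull, hTmul]
      rw [h2, h3]

lemma wE_none_le (hT : ∀ g, Measurable (T g)) (hα : Measurable α) {p : X → ℕ}
    (hp : Measurable p) : wE μ T α (sAlgG T p) none ≤ Hpart μ α :=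
  HpartC_le_Hpart (fun k => hα (measurableSet_singleton k)) (sAlgG_le hT hp)

lemma wE_some_le (hTmul : ∀ g h : FG r, T (g * h) = T g ∘ T h)
    (hTmp : ∀ g, MeasurePreserving (T g) μ μ) (hα : Measurable α) {p : X → ℕ}
    (hp : Measurable p) (x : Fin r × Bool) :
    wE μ T α (sAlgG T p) (some x) ≤ wE μ T α (sAlgG T p) none := by
  have hT : ∀ g, Measurable (T g) := fun g => (hTmp g).measurable
  have h := HpartC_comp_mp (p := α) (fun k => hα (measurableSet_singleton k)) (hTmp (gen x))
    (sAlgG_le hT hp)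
  rw [sAlgG_comap hTmul] at h
  show HpartC μ (pull T (gen x) α) (sAlg α ⊔ _) ≤ HpartC μ α _
  rw [← h]
  exact HpartC_anti (measurableSet_pull hT hα (gen x)) le_sup_right
    (sup_le (sAlg_le hα) (sAlgG_le hT hp))

lemma sAlgG_change (hTmp : ∀ g, MeasurePreserving (T g) μ μ) {p q : X → ℕ} (hp : Measurable p)
    (hq : Measurable q) (h : p =ᵐ[μ] q) {f : X → ℝ} (hf : Integrable f μ) :
    μ[f | sAlgG T p] =ᵐ[μ] μ[f | sAlgG T q] := by
  rw [sAlgG_eq_comap, sAlgG_eq_comap]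
  have hT : ∀ g, Measurable (T g) := fun g => (hTmp g).measurable
  refine condExp_comap_congr (measurable_pi_lambda _ fun g => hp.comp (hT g))
    (measurable_pi_lambda _ fun g => hq.comp (hT g)) ?_ hf
  have h1 : ∀ᵐ x ∂μ, ∀ g : FG r, p (T g x) = q (T g x) := by
    have : Countable (FG r) := FreeGroup.toWord_injective.countable
    rw [ae_all_iff]
    intro g
    exact (hTmp g).quasiMeasurePreserving.ae h
  filter_upwards [h1] with x hx
  ext g
  exact hx g

lemma exists_factor {β : X → ℕ} (hcoarse : Refines μ α β) :
    ∃ b : ℕ → ℕ, β =ᵐ[μ] fun x => b (α x) := by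
  choose b hb using hcoarse
  refine ⟨b, ?_⟩
  have h := measure_iUnion_null hb
  refine measure_mono_null ?_ h
  intro x hx
  rw [Set.mem_iUnion]
  exact ⟨α x, rfl, fun h => hx h⟩

/-- the entropy formula in real numbers -/
lemma entropy_real (hT1 : T 1 = id) (hTmul : ∀ g h : FG r, T (g * h) = T g ∘ T h)
    (hTmp : ∀ g, MeasurePreserving (T g) μ μ) (hα : Measurable α) (hM : IsMarkov μ T α)
    (hH : Hpart μ α < ⊤) {β : X → ℕ} (hβ : Measurable β) (hcoarse : Refines μ α β) :
    ∃ ω : Option (Fin r × Bool) → ℝ, (∀ o, 0 ≤ ω o) ∧ (∀ a, ω (some a) ≤ ω none) ∧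
      ∀ Q : Finset (FG r), TailClosed Q →
        (HpartC μ (powS T α (Q : Set (FG r))) (sAlgG T β)).toReal = ∑ g ∈ Q, wt ω g := by
  have hT : ∀ g, Measurable (T g) := fun g => (hTmp g).measurable
  obtain ⟨b, hb⟩ := exists_factor hcoarse
  have hbα : Measurable (fun x => b (α x)) := (measurable_of_countable b).comp hα
  have h0 : wE μ T α (sAlgG T (fun x => b (α x))) none < ⊤ := (wE_none_le hT hα hbα).trans_lt hH
  have h1 : ∀ o, wE μ T α (sAlgG T (fun x => b (α x))) o < ⊤ := by
    rintro (_ | x)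
    · exact h0
    · exact (wE_some_le hTmul hTmp hα hbα x).trans_lt h0
  refine ⟨fun o => (wE μ T α (sAlgG T (fun x => b (α x))) o).toReal, fun _ => ENNReal.toReal_nonneg,
    fun a => ENNReal.toReal_mono h0.ne (wE_some_le hTmul hTmp hα hbα a), fun Q hQ => ?_⟩
  rw [HpartC_congr_condExp (measurable_powS_atom hT hα Q) (fun k =>
    sAlgG_change hTmp hβ hbα hb (integrable_ind (measurable_powS_atom hT hα Q k))),
    entropy_formula hT1 hTmul hTmp hα hM b Q hQ, ENNReal.toReal_sum (fun g _ => (h1 _).ne)]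
  rfl

lemma iInf_rate {φ S : ℝ} (hS : 0 ≤ S) (h : S ≤ φ) :
    ⨅ m : ℕ, (φ + m * S) / ((m : ℝ) + 1) = S := by
  have hlow : ∀ m : ℕ, S ≤ (φ + m * S) / ((m : ℝ) + 1) := by
    intro m
    rw [le_div_iff₀ (by positivity)]
    linarith
  apply le_antisymm
  · have hbd : BddBelow (Set.range fun m : ℕ => (φ + m * S) / ((m : ℝ) + 1)) :=
      ⟨S, by rintro _ ⟨m, rfl⟩; exact hlow m⟩
    have hlim : Tendsto (fun m : ℕ => S + (φ - S) * (1 / ((m : ℝ) + 1))) atTop (nhds S) := by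
      have := (tendsto_one_div_add_atTop_nhds_zero_nat (𝕜 := ℝ)).const_mul (φ - S)
      simpa using this.const_add S
    refine ge_of_tendsto' hlim fun m => ?_
    refine (ciInf_le hbd m).trans (le_of_eq ?_)
    field_simp
    ring
  · exact le_ciInf hlow

end Entropy

/-- for a Markov process `(T,X,μ,α)` and a coarsening `β` of `α`,
`f(α|β^G) = F(α|β^G) = F_*(α|β^G) = f_*(α|β^G)`. -/
theorem stmt_8 {r : ℕ} (hr : 1 ≤ r) {X : Type*} [MeasurableSpace X] [StandardBorelSpace X]
    (μ : Measure X) [IsProbabilityMeasure μ]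
    (T : FG r → X → X) (hT1 : T 1 = id)
    (hTmul : ∀ g h : FG r, T (g * h) = T g ∘ T h)
    (hTmp : ∀ g : FG r, MeasurePreserving (T g) μ μ)
    (α β : X → ℕ) (hαm : Measurable α) (hβm : Measurable β)
    (hHα : Hpart μ α < ⊤)
    (hmarkov : IsMarkov μ T α) (hcoarse : Refines μ α β) :
    littleFc T μ (sAlgG T β) α = ((FFc T μ (sAlgG T β) α : ℝ) : EReal) ∧
      FFc T μ (sAlgG T β) α = FstarC T μ (sAlgG T β) α ∧
      fstarC T μ (sAlgG T β) α = ((FstarC T μ (sAlgG T β) α : ℝ) : EReal) := by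
  obtain ⟨ω, hω0, hω1, hω⟩ := entropy_real hT1 hTmul hTmp hαm hmarkov hHα hβm hcoarse
  -- entropy of the translates
  have hHB : ∀ n, (HpartC μ (pow T α n) (sAlgG T β)).toReal = ∑ g ∈ ballF r n, wt ω g := by
    intro n
    rw [← hω (ballF r n) (tailClosed_Qset n 0 (⟨0, by omega⟩, true))]
    congr 1
    apply HpartC_congr_ker
    intro x y
    constructor
    · intro h; ext ⟨q, hq⟩
      exact congrFun h ⟨q, mem_ballF.1 (Finset.mem_coe.1 hq)⟩
    · intro h; ext ⟨q, hq⟩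
      exact congrFun h ⟨q, Finset.mem_coe.2 (mem_ballF.2 hq)⟩
  have hgen : ∀ i : Fin r, gen (i, true) = FreeGroup.of i := fun i => rfl
  have hHQ : ∀ n (i : Fin r) m,
      (HpartC μ (fun x (j : Fin (m + 1)) => pow T α n (T (FreeGroup.of i ^ (j : ℕ)) x))
        (sAlgG T β)).toReal = ∑ g ∈ ballF r n, wt ω g + m * Ssum ω n (i, true) := by
    intro n i m
    rw [← Qset_sum, ← hω _ (tailClosed_Qset n m (i, true))]
    congr 1
    apply HpartC_congr_ker
    intro x y
    constructor
    · intro h; ext ⟨q, hq⟩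
      obtain ⟨j, hj, hn⟩ := mem_Qset_iff.1 (Finset.mem_coe.1 hq)
      have h1 := congrFun (congrFun h ⟨j, by omega⟩) ⟨q * (gen (i, true) ^ j)⁻¹, hn⟩
      have h2 : ∀ z, T (q * (gen (i, true) ^ j)⁻¹) (T (FreeGroup.of i ^ j) z) = T q z := by
        intro z
        rw [← Function.comp_apply (f := T _), ← hTmul, hgen, inv_mul_cancel_right]
      simpa only [pow, powS, h2] using h1
    · intro h; ext j ⟨q, hq⟩
      have hq' : q * FreeGroup.of i ^ (j : ℕ) ∈ Qset r n (i, true) m := by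
        rw [mem_Qset_iff]
        refine ⟨j, by omega, ?_⟩
        rw [hgen, mul_inv_cancel_right]
        exact hq
      have h1 := congrFun h ⟨_, Finset.mem_coe.2 hq'⟩
      simpa only [pow, powS, hTmul, Function.comp_apply] using h1
  have hHJ : ∀ n (i : Fin r),
      (HpartC μ (pjoin (pow T α n) (pull T (FreeGroup.of i) (pow T α n)))
        (sAlgG T β)).toReal = ∑ g ∈ ballF r n, wt ω g + Ssum ω n (i, true) := by
    intro n i
    have h := hHQ n i 1
    rw [Nat.cast_one, one_mul] at h
    rw [← h]
    congr 1
    apply HpartC_congr_ker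
    intro x y
    rw [funext_iff, Fin.forall_fin_two, pjoin, pjoin, Prod.ext_iff]
    simp [pull, hT1]
  set c : ℝ := (1 - (r : ℝ)) * ∑ g ∈ ballF r 0, wt ω g + ∑ i : Fin r, Ssum ω 0 (i, true) with hc
  have hFF : ∀ n, FFc T μ (sAlgG T β) (pow T α n) = c := by
    intro n
    rw [FFc, hHB]
    simp_rw [hHJ]
    rw [hc, ← count_const ω n, Finset.sum_add_distrib, Finset.sum_const, Finset.card_univ,
      Fintype.card_fin, nsmul_eq_mul]
    ring
  have hFS : ∀ n, FstarC T μ (sAlgG T β) (pow T α n) = c := by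
    intro n
    have hrt : ∀ i : Fin r, hrateC T μ (sAlgG T β) (FreeGroup.of i) (pow T α n)
        = Ssum ω n (i, true) := by
      intro i
      rw [hrateC]
      simp_rw [hHQ]
      exact iInf_rate (Ssum_nonneg ω hω0 n _) (Ssum_le ω hω0 hω1 n _)
    rw [FstarC, hHB]
    simp_rw [hrt]
    rw [hc, ← count_const ω n]
  have hker : ∀ x y, α x = α y ↔ pow T α 0 x = pow T α 0 y := by
    intro x y
    constructor
    · intro h; ext ⟨q, hq⟩
      have hq' : q = 1 := FreeGroup.norm_eq_zero.1 (Nat.le_zero.1 hq)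
      subst hq'
      simpa [pow, powS, hT1] using h
    · intro h
      have := congrFun h ⟨1, by simp [ball]⟩
      simpa [pow, powS, hT1] using this
  have hFFα : FFc T μ (sAlgG T β) α = c := by
    rw [← hFF 0, FFc, FFc, HpartC_congr_ker hker]
    congr 1
    refine Finset.sum_congr rfl fun i _ => ?_
    congr 1
    apply HpartC_congr_ker
    intro x y
    simp only [pjoin, pull, Prod.ext_iff, hker]
  have hFSα : FstarC T μ (sAlgG T β) α = c := by
    rw [← hFS 0, FstarC, FstarC, HpartC_congr_ker hker]
    congr 1
    refine Finset.sum_congr rfl fun i _ => ?_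
    rw [hrateC, hrateC]
    refine iInf_congr fun m => ?_
    congr 2
    apply HpartC_congr_ker
    intro x y
    simp only [funext_iff (f := fun _ : Fin (m + 1) => _), hker]
  refine ⟨?_, by rw [hFFα, hFSα], ?_⟩
  · rw [littleFc, hFFα]
    simp_rw [hFF]
    exact ciInf_const
  · rw [fstarC, hFSα]
    simp_rw [hFS]
    exact ciInf_const

end

end Bowen
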